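/- arXiv:2306.03470 — 2 statements merged into one kernel-verified Lean document; each statement's English description precedes it below -/
import Mathlib

section
/- If A = (A_1,…,A_κ) ∈ SL₂(ℝ)^κ is irreducible and L(A) > 0, then A is strongly irreducible. -/
open MeasureTheory

noncomputable section

abbrev Mat2 : Type := Matrix (Fin 2) (Fin 2) ℝ
abbrev SL2 : Type := Matrix.SpecialLinearGroup (Fin 2) ℝ
abbrev E2 : Type := EuclideanSpace ℝ (Fin 2)
abbrev Pone : Type := Projectivization ℝ E2

instance : TopologicalSpace SL2 :=
  inferInstanceAs (TopologicalSpace { A : Mat2 // A.det = 1 })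

/-- The operator norm of a 2×2 real matrix, acting on Euclidean ℝ². -/
def opNorm (M : Mat2) : ℝ := ‖Matrix.toEuclideanCLM (𝕜 := ℝ) M‖

/-- The continuous linear map on Euclidean ℝ² induced by a matrix in SL₂(ℝ). -/
def toEuc (g : SL2) : E2 →L[ℝ] E2 := Matrix.toEuclideanCLM (𝕜 := ℝ) (g : Mat2)

lemma toEuc_injective (g : SL2) : Function.Injective (toEuc g) := by
  intro x y hxy
  have key : ∀ z, toEuc g⁻¹ (toEuc g z) = z := by
    intro z
    have h1 : ((g⁻¹ : SL2) : Mat2) * (g : Mat2) = 1 := by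
      rw [← Matrix.SpecialLinearGroup.coe_mul, inv_mul_cancel,
        Matrix.SpecialLinearGroup.coe_one]
    calc toEuc g⁻¹ (toEuc g z)
        = (Matrix.toEuclideanCLM (𝕜 := ℝ) (((g⁻¹ : SL2) : Mat2) * (g : Mat2))) z := by
          rw [map_mul]; rfl
      _ = z := by rw [h1, map_one]; rfl
  have := congrArg (toEuc g⁻¹) hxy
  rwa [key, key] at this

/-- The projective action of SL₂(ℝ) on the real projective line ℙ¹. -/
def pact (g : SL2) : Pone → Pone :=
  Projectivization.map (toEuc g).toLinearMap (toEuc_injective g)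

instance : MeasurableSpace Pone :=
  inferInstanceAs (MeasurableSpace (Quotient (projectivizationSetoid ℝ E2)))

instance : TopologicalSpace Pone :=
  inferInstanceAs (TopologicalSpace (Quotient (projectivizationSetoid ℝ E2)))

/-- The ordered product `A_{w_{n-1}} ⋯ A_{w_1} A_{w_0}` of the matrices along a word `w`. -/
def wordProd {κ : ℕ} (A : Fin κ → SL2) {n : ℕ} (w : Fin n → Fin κ) : SL2 :=
  (List.ofFn fun i => A (w i)).reverse.prod

/-- The Lyapunov exponent of the random product of the matrices `A_1, …, A_κ` with
probabilities `p_1, …, p_κ`: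
`L(p,A) = inf_{n ≥ 1} (1/n) ∫_Σ log‖A^n(x)‖ dμ_p(x) = inf_{n ≥ 1} (1/n) Σ_w p(w) log‖A_w‖`,
the integral over the Bernoulli measure `μ_p = p^ℤ` being a finite sum over words of
length `n` since the cocycle is locally constant. -/
def lyapLC {κ : ℕ} (p : Fin κ → ℝ) (A : Fin κ → SL2) : ℝ :=
  ⨅ n : {m : ℕ // 0 < m},
    (((n : ℕ) : ℝ))⁻¹ * ∑ w : Fin (n : ℕ) → Fin κ,
      (∏ i, p (w i)) * Real.log (opNorm ((wordProd A w : SL2) : Mat2))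

/-- The distance `‖B₁ − B₂‖` on tuples of matrices (sup of the operator norms of the
differences of the components). -/
def tdist {κ : ℕ} (B₁ B₂ : Fin κ → SL2) : ℝ :=
  ⨆ i, opNorm ((B₁ i : Mat2) - (B₂ i : Mat2))

/-- Strong irreducibility: no nonempty finite set of projective directions is invariant
under (the projective actions of) all of the matrices `A_i`. -/
def StronglyIrreducible {κ : ℕ} (A : Fin κ → SL2) : Prop :=
  ¬ ∃ V : Set Pone, V.Nonempty ∧ V.Finite ∧ ∀ i, pact (A i) '' V = V

/-- Irreducibility: no projective direction is invariant under all of the matrices `A_i`. -/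
def Irreducible' {κ : ℕ} (A : Fin κ → SL2) : Prop :=
  ¬ ∃ v : Pone, ∀ i, pact (A i) v = v

/-! ### Helper material -/

/-- The standard area form. -/
def areaD (x y : E2) : ℝ := x 0 * y 1 - x 1 * y 0

lemma toEuc_apply0 (g : SL2) (x : E2) :
    toEuc g x 0 = (g : Mat2) 0 0 * x 0 + (g : Mat2) 0 1 * x 1 := by
  unfold toEuc
  rw [Matrix.ofLp_toEuclideanCLM]
  simp [Matrix.mulVec, dotProduct, Fin.sum_univ_two]

lemma toEuc_apply1 (g : SL2) (x : E2) :
    toEuc g x 1 = (g : Mat2) 1 0 * x 0 + (g : Mat2) 1 1 * x 1 := by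
  unfold toEuc
  rw [Matrix.ofLp_toEuclideanCLM]
  simp [Matrix.mulVec, dotProduct, Fin.sum_univ_two]

lemma toEuc_mul (g h : SL2) (x : E2) : toEuc (g * h) x = toEuc g (toEuc h x) := by
  unfold toEuc
  rw [Matrix.SpecialLinearGroup.coe_mul, map_mul]; rfl

lemma toEuc_one (x : E2) : toEuc 1 x = x := by
  unfold toEuc
  rw [Matrix.SpecialLinearGroup.coe_one, map_one]; rfl

lemma areaD_toEuc (g : SL2) (x y : E2) : areaD (toEuc g x) (toEuc g y) = areaD x y := by
  have h := g.det_coe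
  rw [Matrix.det_fin_two] at h
  unfold areaD
  rw [toEuc_apply0, toEuc_apply0, toEuc_apply1, toEuc_apply1]
  linear_combination (x 0 * y 1 - x 1 * y 0) * h

lemma areaD_smul (a b : ℝ) (x y : E2) : areaD (a • x) (b • y) = a * b * areaD x y := by
  simp [areaD]; ring

lemma areaD_swap (x y : E2) : areaD y x = - areaD x y := by
  simp [areaD]; ring

lemma areaD_cramer (x y z : E2) : areaD x y • z = areaD z y • x + areaD x z • y := by
  ext i
  fin_cases i <;> simp [areaD] <;> ring

lemma areaD_le (x y : E2) : |areaD x y| ≤ 2 * (‖x‖ * ‖y‖) := by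
  have h (z : E2) (i : Fin 2) : |z i| ≤ ‖z‖ := by
    simpa using PiLp.norm_apply_le z i
  have h1 : |x 0 * y 1| ≤ ‖x‖ * ‖y‖ := by
    rw [abs_mul]; exact mul_le_mul (h _ _) (h _ _) (abs_nonneg _) (norm_nonneg _)
  have h2 : |x 1 * y 0| ≤ ‖x‖ * ‖y‖ := by
    rw [abs_mul]; exact mul_le_mul (h _ _) (h _ _) (abs_nonneg _) (norm_nonneg _)
  have h3 := abs_sub (x 0 * y 1) (x 1 * y 0)
  unfold areaD
  linarith

lemma areaD_ne {v w : Pone} (h : v ≠ w) : areaD v.rep w.rep ≠ 0 := by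
  intro h0
  apply h
  rw [← v.mk_rep, ← w.mk_rep, Projectivization.mk_eq_mk_iff']
  have hw := w.rep_nonzero
  have hor : w.rep 0 ≠ 0 ∨ w.rep 1 ≠ 0 := by
    by_contra hc
    push Not at hc
    apply hw
    ext i
    fin_cases i
    · simpa using hc.1
    · simpa using hc.2
  unfold areaD at h0
  rcases hor with hc | hc
  · refine ⟨v.rep 0 / w.rep 0, ?_⟩
    ext i
    fin_cases i
    · simp; field_simp
    · simp; field_simp; linarith
  · refine ⟨v.rep 1 / w.rep 1, ?_⟩
    ext i
    fin_cases i
    · simp; field_simp; linarith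
    · simp; field_simp

lemma pact_rep {g : SL2} {v w : Pone} (h : pact g v = w) :
    ∃ c : ℝ, toEuc g v.rep = c • w.rep := by
  have h1 : pact g (Projectivization.mk ℝ v.rep v.rep_nonzero)
      = Projectivization.mk ℝ w.rep w.rep_nonzero := by
    rw [v.mk_rep, w.mk_rep, h]
  unfold pact at h1
  rw [Projectivization.map_mk, Projectivization.mk_eq_mk_iff'] at h1
  obtain ⟨a, ha⟩ := h1
  exact ⟨a, ha.symm⟩

lemma pact_inj (g : SL2) : Function.Injective (pact g) :=
  Projectivization.map_injective _ _

lemma pact_one (v : Pone) : pact 1 v = v := by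
  rw [← v.mk_rep]
  unfold pact
  rw [Projectivization.map_mk, Projectivization.mk_eq_mk_iff']
  exact ⟨1, by simp [toEuc_one]⟩

lemma pact_mul (g h : SL2) (v : Pone) : pact (g * h) v = pact g (pact h v) := by
  rw [← v.mk_rep]
  unfold pact
  rw [Projectivization.map_mk, Projectivization.map_mk, Projectivization.map_mk,
    Projectivization.mk_eq_mk_iff']
  exact ⟨1, by simp [toEuc_mul]⟩

/-- Two elements agreeing at three distinct points have the same norm. -/
lemma opNorm_eq_of_three {g h : SL2} {v w z : Pone} (hvw : v ≠ w) (hvz : v ≠ z) (hwz : w ≠ z)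
    (h1 : pact g v = pact h v) (h2 : pact g w = pact h w) (h3 : pact g z = pact h z) :
    opNorm (g : Mat2) = opNorm (h : Mat2) := by
  -- reduce to k = h⁻¹ g
  have key : ∀ u : Pone, pact g u = pact h u → ∃ c : ℝ, toEuc (h⁻¹ * g) u.rep = c • u.rep := by
    intro u hu
    apply pact_rep
    rw [pact_mul, hu, ← pact_mul, inv_mul_cancel, pact_one]
  obtain ⟨a, ha⟩ := key v h1
  obtain ⟨b, hb⟩ := key w h2
  obtain ⟨c, hc⟩ := key z h3
  set k := h⁻¹ * g with hk
  have dvw := areaD_ne hvw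
  have dvz := areaD_ne hvz
  have dwz := areaD_ne hwz
  have e1 : a * b = 1 := by
    have := areaD_toEuc k v.rep w.rep
    rw [ha, hb, areaD_smul] at this
    exact mul_right_cancel₀ dvw (by linarith)
  have e2 : a * c = 1 := by
    have := areaD_toEuc k v.rep z.rep
    rw [ha, hc, areaD_smul] at this
    exact mul_right_cancel₀ dvz (by linarith)
  have e3 : b * c = 1 := by
    have := areaD_toEuc k w.rep z.rep
    rw [hb, hc, areaD_smul] at this
    exact mul_right_cancel₀ dwz (by linarith)
  have hab : a = b := by linear_combination b * e2 - a * e3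
  subst hab
  have hkx : ∀ x : E2, toEuc k x = a • x := by
    intro x
    have hcr := areaD_cramer v.rep w.rep x
    have h4 := congrArg (toEuc k) hcr
    rw [map_add, map_smul, map_smul, map_smul, ha, hb, smul_comm _ a, smul_comm _ a,
      ← smul_add, ← hcr, smul_comm a] at h4
    exact smul_right_injective _ dvw h4
  have hgx : toEuc g = a • toEuc h := by
    ext1 x
    have : g = h * k := by rw [hk]; group
    rw [this, toEuc_mul, hkx, map_smul]; rfl
  have habs : |a| = 1 := by
    have : a ^ 2 = 1 := by linarith
    rcases (by simpa using this : a = 1 ∨ a = -1) with h | h <;> simp [h]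
  have : ‖toEuc g‖ = ‖toEuc h‖ := by
    rw [hgx, norm_smul, Real.norm_eq_abs, habs, one_mul]
  exact this

lemma wordProd_snoc {κ : ℕ} (A : Fin κ → SL2) {n : ℕ} (w : Fin n → Fin κ) (i : Fin κ) :
    wordProd A (Fin.snoc w i : Fin (n + 1) → Fin κ) = A i * wordProd A w := by
  unfold wordProd
  rw [List.ofFn_succ', List.concat_eq_append, List.reverse_append]
  simp

lemma wordProd_zero {κ : ℕ} (A : Fin κ → SL2) (w : Fin 0 → Fin κ) : wordProd A w = 1 := by
  simp [wordProd]

/-- Expectation over words of length `n`. -/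
def Ew {κ : ℕ} (p : Fin κ → ℝ) (n : ℕ) (F : (Fin n → Fin κ) → ℝ) : ℝ :=
  ∑ w : Fin n → Fin κ, (∏ i, p (w i)) * F w

lemma Ew_zero {κ : ℕ} (p : Fin κ → ℝ) (F : (Fin 0 → Fin κ) → ℝ) :
    Ew p 0 F = F Fin.elim0 := by
  unfold Ew
  rw [Fintype.sum_eq_single (Fin.elim0 : Fin 0 → Fin κ)]
  · simp
  · intro w hw
    exact absurd (Subsingleton.elim _ _) hw

lemma Ew_succ {κ : ℕ} (p : Fin κ → ℝ) (n : ℕ) (F : (Fin (n + 1) → Fin κ) → ℝ) :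
    Ew p (n + 1) F = Ew p n (fun w => ∑ i, p i * F (Fin.snoc w i)) := by
  unfold Ew
  rw [← (Fin.snocEquiv (fun _ : Fin (n + 1) => Fin κ)).sum_comp, Fintype.sum_prod_type,
    Finset.sum_comm]
  refine Finset.sum_congr rfl fun w _ => ?_
  rw [Finset.mul_sum]
  refine Finset.sum_congr rfl fun i _ => ?_
  rw [Fin.prod_univ_castSucc]
  simp [Fin.snocEquiv, mul_assoc]

lemma Ew_add {κ : ℕ} (p : Fin κ → ℝ) (n : ℕ) (F G : (Fin n → Fin κ) → ℝ) :
    Ew p n (fun w => F w + G w) = Ew p n F + Ew p n G := by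
  simp [Ew, mul_add, Finset.sum_add_distrib]

lemma Ew_mul {κ : ℕ} (p : Fin κ → ℝ) (n : ℕ) (c : ℝ) (F : (Fin n → Fin κ) → ℝ) :
    Ew p n (fun w => c * F w) = c * Ew p n F := by
  simp only [Ew, Finset.mul_sum]
  exact Finset.sum_congr rfl fun w _ => by ring

lemma Ew_mono {κ : ℕ} (p : Fin κ → ℝ) (hp : ∀ i, 0 < p i) (n : ℕ)
    (F G : (Fin n → Fin κ) → ℝ) (h : ∀ w, F w ≤ G w) : Ew p n F ≤ Ew p n G := by
  unfold Ew
  exact Finset.sum_le_sum fun w _ =>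
    mul_le_mul_of_nonneg_left (h w) (Finset.prod_nonneg fun i _ => (hp _).le)

lemma Ew_const {κ : ℕ} (p : Fin κ → ℝ) (hp1 : ∑ i, p i = 1) (n : ℕ) (c : ℝ) :
    Ew p n (fun _ => c) = c := by
  induction n with
  | zero => rw [Ew_zero]
  | succ n ih =>
    rw [Ew_succ]
    simp only [← Finset.sum_mul, hp1, one_mul]
    exact ih

lemma lyap_le {κ : ℕ} (p : Fin κ → ℝ) (A : Fin κ → SL2) (hL : 0 < lyapLC p A)
    (n : ℕ) (hn : 0 < n) :
    n * lyapLC p A ≤ Ew p n (fun w => Real.log (opNorm ((wordProd A w : SL2) : Mat2))) := by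
  have hle : lyapLC p A ≤ (n : ℝ)⁻¹ *
      Ew p n (fun w => Real.log (opNorm ((wordProd A w : SL2) : Mat2))) := by
    by_cases hb : BddBelow (Set.range fun n : {m : ℕ // 0 < m} =>
      (((n : ℕ) : ℝ))⁻¹ * ∑ w : Fin (n : ℕ) → Fin κ,
      (∏ i, p (w i)) * Real.log (opNorm ((wordProd A w : SL2) : Mat2)))
    · exact ciInf_le hb ⟨n, hn⟩
    · exfalso
      have : lyapLC p A = 0 := Real.iInf_of_not_bddBelow hb
      linarith
  have hn' : (0 : ℝ) < n := by exact_mod_cast hn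
  calc n * lyapLC p A ≤ n * ((n : ℝ)⁻¹ * _) := mul_le_mul_of_nonneg_left hle hn'.le
    _ = _ := by rw [← mul_assoc, mul_inv_cancel₀ hn'.ne', one_mul]

lemma opNorm_nonneg (M : Mat2) : 0 ≤ opNorm M := norm_nonneg _

lemma log_opNorm_le (M : Mat2) (C : ℝ) (hC : 0 ≤ C) (h : opNorm M ≤ Real.exp C) :
    Real.log (opNorm M) ≤ C := by
  rcases (opNorm_nonneg M).eq_or_lt with h0 | h0
  · rw [← h0, Real.log_zero]; exact hC
  · exact (Real.log_le_iff_le_exp h0).2 h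

/-- Three points: contradiction. -/
lemma three_points {κ : ℕ} (p : Fin κ → ℝ)
    (hp : ∀ i, 0 < p i) (hp1 : ∑ i, p i = 1) (A : Fin κ → SL2) (hL : 0 < lyapLC p A)
    (V : Set Pone) (hV : V.Finite) (hA : ∀ i, pact (A i) '' V = V)
    {v w z : Pone} (hv : v ∈ V) (hw : w ∈ V) (hz : z ∈ V)
    (hvw : v ≠ w) (hvz : v ≠ z) (hwz : w ≠ z) : False := by
  have hword : ∀ n (s : Fin n → Fin κ), ∀ u ∈ V, pact (wordProd A s) u ∈ V := by
    intro n
    induction n with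
    | zero => intro s u hu; rw [wordProd_zero, pact_one]; exact hu
    | succ n ih =>
      intro s u hu
      rw [← Fin.snoc_init_self s, wordProd_snoc, pact_mul, ← hA (s (Fin.last n))]
      exact ⟨_, ih _ u hu, rfl⟩
  let S : Set SL2 := {g | ∀ u ∈ V, pact g u ∈ V}
  have hfin : ((fun g : SL2 => opNorm (g : Mat2)) '' S).Finite := by
    let φ : SL2 → Pone × Pone × Pone := fun g => (pact g v, pact g w, pact g z)
    have hφ : (φ '' S).Finite := by
      apply (hV.prod (hV.prod hV)).subset
      rintro _ ⟨g, hg, rfl⟩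
      exact ⟨hg v hv, hg w hw, hg z hz⟩
    let ψ : Pone × Pone × Pone → ℝ := fun t => opNorm ((Function.invFunOn φ S t : SL2) : Mat2)
    apply (hφ.image ψ).subset
    rintro _ ⟨g, hg, rfl⟩
    refine ⟨φ g, ⟨g, hg, rfl⟩, ?_⟩
    have := Function.invFunOn_eq (f := φ) (s := S) ⟨g, hg, rfl⟩
    simp only [φ, Prod.mk.injEq] at this
    exact opNorm_eq_of_three hvw hvz hwz this.1 this.2.1 this.2.2
  obtain ⟨C, hC⟩ := hfin.bddAbove
  have hb : ∀ n : ℕ, 0 < n → n * lyapLC p A ≤ |C| := by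
    intro n hn
    refine (lyap_le p A hL n hn).trans ?_
    refine (Ew_mono p hp n _ (fun _ => |C|) fun s => ?_).trans (Ew_const p hp1 n _).le
    apply log_opNorm_le _ _ (abs_nonneg _)
    have h1 : opNorm ((wordProd A s : SL2) : Mat2) ≤ C := hC ⟨_, hword n s, rfl⟩
    have h2 := Real.add_one_le_exp |C|
    have h3 := le_abs_self C
    linarith
  obtain ⟨n, hn⟩ := exists_nat_gt (|C| / lyapLC p A)
  have hn0 : (0 : ℝ) < n := lt_of_le_of_lt (by positivity) hn
  have h1 := hb n (by exact_mod_cast hn0)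
  rw [div_lt_iff₀ hL] at hn
  linarith

/-- `g` acts on the frame `(u, v)` monomially with log-scale `x` and sign `e`. -/
def Mono (u v : E2) (g : SL2) (x e : ℝ) : Prop :=
  (e = 1 ∧ ∃ a b : ℝ, toEuc g u = a • u ∧ toEuc g v = b • v ∧
    |a| = Real.exp x ∧ |b| = Real.exp (-x)) ∨
  (e = -1 ∧ ∃ a b : ℝ, toEuc g u = a • v ∧ toEuc g v = b • u ∧
    |a| = Real.exp x ∧ |b| = Real.exp (-x))

lemma Mono_one (u v : E2) : Mono u v 1 0 1 := by
  left
  exact ⟨rfl, 1, 1, by simp [toEuc_one], by simp [toEuc_one], by simp, by simp⟩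

lemma Mono_mul {u v : E2} {g h : SL2} {x e s t : ℝ} (hg : Mono u v g x e) (hh : Mono u v h s t) :
    Mono u v (h * g) (x + e * s) (e * t) := by
  rcases hg with ⟨rfl, a, b, h1, h2, h3, h4⟩ | ⟨rfl, a, b, h1, h2, h3, h4⟩ <;>
  rcases hh with ⟨rfl, c, d, k1, k2, k3, k4⟩ | ⟨rfl, c, d, k1, k2, k3, k4⟩
  · left
    refine ⟨by norm_num, a * c, b * d, ?_, ?_, ?_, ?_⟩
    · rw [toEuc_mul, h1, map_smul, k1, smul_smul]
    · rw [toEuc_mul, h2, map_smul, k2, smul_smul]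
    · rw [abs_mul, h3, k3, ← Real.exp_add]; ring_nf
    · rw [abs_mul, h4, k4, ← Real.exp_add]; ring_nf
  · right
    refine ⟨by norm_num, a * c, b * d, ?_, ?_, ?_, ?_⟩
    · rw [toEuc_mul, h1, map_smul, k1, smul_smul]
    · rw [toEuc_mul, h2, map_smul, k2, smul_smul]
    · rw [abs_mul, h3, k3, ← Real.exp_add]; ring_nf
    · rw [abs_mul, h4, k4, ← Real.exp_add]; ring_nf
  · right
    refine ⟨by norm_num, a * d, b * c, ?_, ?_, ?_, ?_⟩
    · rw [toEuc_mul, h1, map_smul, k2, smul_smul]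
    · rw [toEuc_mul, h2, map_smul, k1, smul_smul]
    · rw [abs_mul, h3, k4, ← Real.exp_add]; ring_nf
    · rw [abs_mul, h4, k3, ← Real.exp_add]; ring_nf
  · left
    refine ⟨by norm_num, a * d, b * c, ?_, ?_, ?_, ?_⟩
    · rw [toEuc_mul, h1, map_smul, k2, smul_smul]
    · rw [toEuc_mul, h2, map_smul, k1, smul_smul]
    · rw [abs_mul, h3, k4, ← Real.exp_add]; ring_nf
    · rw [abs_mul, h4, k3, ← Real.exp_add]; ring_nf

lemma abs_exp_of_prod {a b : ℝ} (h : |a * b| = 1) :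
    |a| = Real.exp (Real.log |a|) ∧ |b| = Real.exp (-Real.log |a|) := by
  rw [abs_mul] at h
  have ha : 0 < |a| := by
    rcases (abs_nonneg a).eq_or_lt with h0 | h0
    · rw [← h0] at h; norm_num at h
    · exact h0
  refine ⟨(Real.exp_log ha).symm, ?_⟩
  rw [Real.exp_neg, Real.exp_log ha]
  field_simp
  linarith

lemma Mono_fix {v w : Pone} (hvw : v ≠ w) {g : SL2} (h1 : pact g v = v) (h2 : pact g w = w) :
    ∃ x, Mono v.rep w.rep g x 1 := by
  obtain ⟨a, ha⟩ := pact_rep h1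
  obtain ⟨b, hb⟩ := pact_rep h2
  have d := areaD_ne hvw
  have e1 : a * b = 1 := by
    have := areaD_toEuc g v.rep w.rep
    rw [ha, hb, areaD_smul] at this
    exact mul_right_cancel₀ d (by linarith)
  have := abs_exp_of_prod (a := a) (b := b) (by rw [e1]; simp)
  exact ⟨_, Or.inl ⟨rfl, a, b, ha, hb, this.1, this.2⟩⟩

lemma Mono_swap {v w : Pone} (hvw : v ≠ w) {g : SL2} (h1 : pact g v = w) (h2 : pact g w = v) :
    ∃ x, Mono v.rep w.rep g x (-1) := by
  obtain ⟨a, ha⟩ := pact_rep h1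
  obtain ⟨b, hb⟩ := pact_rep h2
  have d := areaD_ne hvw
  have e1 : a * b = -1 := by
    have := areaD_toEuc g v.rep w.rep
    rw [ha, hb, areaD_smul, areaD_swap] at this
    exact mul_right_cancel₀ d (by linarith)
  have := abs_exp_of_prod (a := a) (b := b) (by rw [e1]; simp)
  exact ⟨_, Or.inr ⟨rfl, a, b, ha, hb, this.1, this.2⟩⟩

lemma Mono_norm {u v : E2} (hd : areaD u v ≠ 0) :
    ∃ C : ℝ, 0 ≤ C ∧ ∀ g x e, Mono u v g x e →
      Real.log (opNorm (g : Mat2)) ≤ C + |x| := by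
  set K : ℝ := |areaD u v|⁻¹ * (2 * (‖u‖ + ‖v‖) * (2 * (‖u‖ + ‖v‖))) with hK
  have hd' : 0 < |areaD u v| := abs_pos.2 hd
  have hK0 : 0 ≤ K := by positivity
  refine ⟨K, hK0, ?_⟩
  intro g x e hg
  have hbound : ‖toEuc g u‖ ≤ Real.exp |x| * (‖u‖ + ‖v‖) ∧
      ‖toEuc g v‖ ≤ Real.exp |x| * (‖u‖ + ‖v‖) := by
    have e1 : Real.exp x ≤ Real.exp |x| := Real.exp_le_exp.2 (le_abs_self x)
    have e2 : Real.exp (-x) ≤ Real.exp |x| := Real.exp_le_exp.2 (neg_le_abs x)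
    have hu : ‖u‖ ≤ ‖u‖ + ‖v‖ := le_add_of_nonneg_right (norm_nonneg _)
    have hv : ‖v‖ ≤ ‖u‖ + ‖v‖ := le_add_of_nonneg_left (norm_nonneg _)
    rcases hg with ⟨-, a, b, h1, h2, h3, h4⟩ | ⟨-, a, b, h1, h2, h3, h4⟩ <;>
    rw [h1, h2, norm_smul, norm_smul, Real.norm_eq_abs, Real.norm_eq_abs, h3, h4] <;>
    constructor <;> gcongr
  apply log_opNorm_le _ _ (by positivity)
  have hop : opNorm (g : Mat2) ≤ K * Real.exp |x| := by
    refine ContinuousLinearMap.opNorm_le_bound (toEuc g) (by positivity) fun z => ?_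
    have hz : |areaD u v| * ‖toEuc g z‖ ≤
        (2 * (‖u‖ + ‖v‖) * (2 * (‖u‖ + ‖v‖))) * Real.exp |x| * ‖z‖ := by
      have hcr := congrArg (toEuc g) (areaD_cramer u v z)
      rw [map_add, map_smul, map_smul, map_smul] at hcr
      have h5 := congrArg norm hcr
      rw [norm_smul, Real.norm_eq_abs] at h5
      rw [h5]
      refine (norm_add_le _ _).trans ?_
      rw [norm_smul, norm_smul, Real.norm_eq_abs, Real.norm_eq_abs]
      have f1 : |areaD z v| ≤ 2 * (‖z‖ * (‖u‖ + ‖v‖)) := by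
        refine (areaD_le z v).trans ?_
        have := norm_nonneg u
        gcongr; linarith
      have f2 : |areaD u z| ≤ 2 * (‖z‖ * (‖u‖ + ‖v‖)) := by
        refine (areaD_le u z).trans ?_
        have := norm_nonneg v
        rw [mul_comm ‖u‖]
        gcongr; linarith
      have g1 := mul_le_mul f1 hbound.1 (norm_nonneg _) (by positivity)
      have g2 := mul_le_mul f2 hbound.2 (norm_nonneg _) (by positivity)
      refine (add_le_add g1 g2).trans (le_of_eq ?_)
      ring
    rw [hK]
    rw [mul_assoc, mul_assoc, inv_mul_eq_div, le_div_iff₀ hd']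
    linarith
  refine hop.trans ?_
  rw [Real.exp_add]
  have := Real.add_one_le_exp K
  gcongr
  linarith

/-- log-scale and sign along a word. -/
def walk {κ : ℕ} (s t : Fin κ → ℝ) : (n : ℕ) → (Fin n → Fin κ) → ℝ × ℝ
  | 0, _ => (0, 1)
  | n + 1, w =>
    let y := walk s t n (Fin.init w)
    (y.1 + y.2 * s (w (Fin.last n)), y.2 * t (w (Fin.last n)))

lemma walk_snoc {κ : ℕ} (s t : Fin κ → ℝ) (n : ℕ) (w : Fin n → Fin κ) (i : Fin κ) :
    walk s t (n + 1) (Fin.snoc w i : Fin (n + 1) → Fin κ) =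
      ((walk s t n w).1 + (walk s t n w).2 * s i, (walk s t n w).2 * t i) := by
  simp [walk]

lemma two_points {κ : ℕ} (p : Fin κ → ℝ)
    (hp : ∀ i, 0 < p i) (hp1 : ∑ i, p i = 1) (A : Fin κ → SL2) (hL : 0 < lyapLC p A)
    (u v : E2) (hd : areaD u v ≠ 0) (s t : Fin κ → ℝ)
    (hst : ∀ i, Mono u v (A i) (s i) (t i)) (hneg : ∃ i, t i = -1) : False := by
  have ht : ∀ i, t i = 1 ∨ t i = -1 := by
    intro i
    rcases hst i with h | h
    · exact Or.inl h.1
    · exact Or.inr h.1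
  have hmono : ∀ n (w : Fin n → Fin κ),
      Mono u v (wordProd A w) (walk s t n w).1 (walk s t n w).2 := by
    intro n
    induction n with
    | zero => intro w; rw [wordProd_zero]; exact Mono_one u v
    | succ n ih =>
      intro w
      rw [← Fin.snoc_init_self w, wordProd_snoc, walk_snoc]
      exact Mono_mul (ih _) (hst _)
  have hsign : ∀ n (w : Fin n → Fin κ), (walk s t n w).2 * (walk s t n w).2 = 1 := by
    intro n w
    rcases hmono n w with h | h <;> rw [h.1] <;> norm_num
  set q := ∑ i, p i * t i with hq
  set c := ∑ i, p i * (s i * t i) with hc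
  set m := ∑ i, p i * s i with hm
  set r := ∑ i, p i * (s i * s i) with hr
  have hq1 : q < 1 := by
    rw [← hp1]
    obtain ⟨j, hj⟩ := hneg
    refine Finset.sum_lt_sum (fun i _ => ?_) ⟨j, Finset.mem_univ _, ?_⟩
    · have := hp i
      rcases ht i with h | h <;> rw [h] <;> linarith
    · have := hp j
      rw [hj]; linarith
  have hq2 : -1 ≤ q := by
    rw [← hp1, ← Finset.sum_neg_distrib]
    refine Finset.sum_le_sum (fun i _ => ?_)
    have := hp i
    rcases ht i with h | h <;> rw [h] <;> linarith
  let Y : ℕ → ℝ := fun n => Ew p n fun w => (walk s t n w).1 * (walk s t n w).2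
  let Z : ℕ → ℝ := fun n => Ew p n fun w => (walk s t n w).1 * (walk s t n w).1
  have hY : ∀ n, Y (n + 1) = q * Y n + c := by
    intro n
    change Ew p (n + 1) _ = q * Ew p n _ + c
    rw [Ew_succ, ← Ew_mul, ← Ew_const p hp1 n c, ← Ew_add]
    congr 1
    funext w
    rw [hq, hc, Finset.sum_mul, ← Finset.sum_add_distrib]
    refine Finset.sum_congr rfl fun i _ => ?_
    rw [walk_snoc]
    linear_combination p i * s i * t i * hsign n w
  have hZ : ∀ n, Z (n + 1) = Z n + (2 * m * Y n + r) := by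
    intro n
    change Ew p (n + 1) _ = Ew p n _ + (2 * m * Ew p n _ + r)
    rw [Ew_succ, ← Ew_mul, ← Ew_const p hp1 n r, ← Ew_add, ← Ew_add]
    congr 1
    funext w
    have h1 : (walk s t n w).1 * (walk s t n w).1
        = ∑ i, p i * ((walk s t n w).1 * (walk s t n w).1) := by
      rw [← Finset.sum_mul, hp1, one_mul]
    rw [h1, hm, hr, Finset.mul_sum, Finset.sum_mul, ← Finset.sum_add_distrib,
      ← Finset.sum_add_distrib]
    refine Finset.sum_congr rfl fun i _ => ?_
    rw [walk_snoc]
    linear_combination p i * s i * s i * hsign n w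
  have hY0 : Y 0 = 0 := by
    change Ew p 0 _ = 0
    rw [Ew_zero]; simp [walk]
  have hZ0 : Z 0 = 0 := by
    change Ew p 0 _ = 0
    rw [Ew_zero]; simp [walk]
  have hYf : ∀ n, (1 - q) * Y n = c * (1 - q ^ n) := by
    intro n
    induction n with
    | zero => rw [hY0]; simp
    | succ n ih => rw [hY, pow_succ]; linear_combination q * ih
  set B := 2 * |c| / (1 - q) with hB
  have h1q : 0 < 1 - q := by linarith
  have hYB : ∀ n, |Y n| ≤ B := by
    intro n
    rw [hB, le_div_iff₀ h1q]
    have h1 : |Y n| * (1 - q) = |c| * |1 - q ^ n| := by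
      rw [← abs_mul, ← hYf, abs_mul, abs_of_pos h1q, mul_comm]
    rw [h1]
    have h2 : |q ^ n| ≤ 1 := by
      rw [abs_pow]
      exact pow_le_one₀ (abs_nonneg _) (abs_le.2 ⟨hq2, hq1.le⟩)
    have h3 : |1 - q ^ n| ≤ 2 := by
      rw [abs_le] at h2 ⊢
      constructor <;> linarith [h2.1, h2.2]
    have := mul_le_mul_of_nonneg_left h3 (abs_nonneg c)
    linarith
  set K := 2 * |m| * B + |r| + 1 with hKdef
  have hB0 : 0 ≤ B := (abs_nonneg _).trans (hYB 0)
  have hK0 : 0 < K := by positivity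
  have hZK : ∀ n : ℕ, Z n ≤ K * n := by
    intro n
    induction n with
    | zero => rw [hZ0]; simp
    | succ n ih =>
      rw [hZ]
      have h1 : m * Y n ≤ |m| * B := by
        refine (le_abs_self _).trans ?_
        rw [abs_mul]
        exact mul_le_mul_of_nonneg_left (hYB n) (abs_nonneg _)
      have h2 := le_abs_self r
      push_cast
      linarith
  obtain ⟨C, hC0, hC⟩ := Mono_norm hd
  set L := lyapLC p A with hLdef
  have hmain : ∀ n : ℕ, 0 < n → n * L ≤ C + K / (2 * L) + L / (2 * K) * (K * n) := by
    intro n hn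
    refine (lyap_le p A hL n hn).trans ?_
    have h1 : Ew p n (fun w => Real.log (opNorm ((wordProd A w : SL2) : Mat2))) ≤
        Ew p n (fun w => (C + K / (2 * L)) +
          L / (2 * K) * ((walk s t n w).1 * (walk s t n w).1)) := by
      apply Ew_mono p hp
      intro w
      refine (hC _ _ _ (hmono n w)).trans ?_
      set x := (walk s t n w).1
      have h2 : x * x = |x| ^ 2 := by rw [sq_abs]; ring
      rw [h2]
      have h3 : K / (2 * L) + L / (2 * K) * |x| ^ 2 - |x| = (K - L * |x|) ^ 2 / (2 * K * L) := by
        field_simp; ring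
      have h4 : 0 ≤ (K - L * |x|) ^ 2 / (2 * K * L) := by positivity
      linarith
    refine h1.trans ?_
    rw [Ew_add, Ew_const p hp1, Ew_mul]
    have := mul_le_mul_of_nonneg_left (hZK n) (show 0 ≤ L / (2 * K) by positivity)
    simp only [Z] at this
    linarith
  obtain ⟨n, hn⟩ := exists_nat_gt ((C + K / (2 * L)) / (L / 2))
  have hn0 : (0 : ℝ) < n := lt_of_le_of_lt (by positivity) hn
  have h1 := hmain n (by exact_mod_cast hn0)
  rw [div_lt_iff₀ (by positivity)] at hn
  have h2 : L / (2 * K) * (K * n) = n * (L / 2) := by field_simp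
  linarith

/-- If `A` is irreducible and `L(A) > 0`, then `A` is strongly irreducible. -/
theorem irreducible_of_positive_exponent {κ : ℕ} (hκ : 2 ≤ κ) (p : Fin κ → ℝ)
    (hp : ∀ i, 0 < p i) (hp1 : ∑ i, p i = 1) (A : Fin κ → SL2)
    (hIrr : Irreducible' A) (hL : 0 < lyapLC p A) :
    StronglyIrreducible A := by
  rintro ⟨V, ⟨v, hv⟩, hfin, hA⟩
  have hmem : ∀ i, ∀ u ∈ V, pact (A i) u ∈ V := by
    intro i u hu
    rw [← hA i]
    exact ⟨u, hu, rfl⟩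
  by_cases h1 : ∃ w ∈ V, w ≠ v
  · obtain ⟨w, hw, hwv⟩ := h1
    by_cases h2 : ∃ z ∈ V, z ≠ v ∧ z ≠ w
    · obtain ⟨z, hz, hzv, hzw⟩ := h2
      exact three_points p hp hp1 A hL V hfin hA hv hw hz hwv.symm hzv.symm hzw.symm
    · have hVor : ∀ z ∈ V, z = v ∨ z = w := by
        intro z hz
        by_contra hcon
        push Not at hcon
        exact h2 ⟨z, hz, hcon⟩
      have hdich : ∀ i, (pact (A i) v = v ∧ pact (A i) w = w) ∨
          (pact (A i) v = w ∧ pact (A i) w = v) := by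
        intro i
        have hne : pact (A i) w ≠ pact (A i) v := fun h => hwv (pact_inj _ h)
        rcases hVor _ (hmem i v hv) with ha | ha <;> rcases hVor _ (hmem i w hw) with hb | hb
        · exact absurd (hb.trans ha.symm) hne
        · exact Or.inl ⟨ha, hb⟩
        · exact Or.inr ⟨ha, hb⟩
        · exact absurd (hb.trans ha.symm) hne
      have hex : ∀ i, ∃ x e, Mono v.rep w.rep (A i) x e ∧ (pact (A i) v = w → e = -1) := by
        intro i
        rcases hdich i with ⟨ha, hb⟩ | ⟨ha, hb⟩
        · obtain ⟨x, hx⟩ := Mono_fix hwv.symm ha hb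
          exact ⟨x, 1, hx, fun h => absurd (h.symm.trans ha) hwv⟩
        · obtain ⟨x, hx⟩ := Mono_swap hwv.symm ha hb
          exact ⟨x, -1, hx, fun _ => rfl⟩
      choose s t hst using hex
      refine two_points p hp hp1 A hL v.rep w.rep (areaD_ne hwv.symm) s t
        (fun i => (hst i).1) ?_
      by_contra hcon
      apply hIrr
      refine ⟨v, fun i => ?_⟩
      rcases hdich i with h | h
      · exact h.1
      · exact absurd ⟨i, (hst i).2 h.1⟩ hcon
  · push Not at h1
    exact hIrr ⟨v, fun i => h1 _ (hmem i v hv)⟩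
end
end

section
/- For every fixed probability vector p with all entries positive, the Lyapunov exponent function L : SL₂(ℝ)^κ → ℝ, A ↦ L(A), is continuous. (Bocker–Viana continuity theorem.) -/
open MeasureTheory

noncomputable section

namespace BV

variable {κ : ℕ}

/-- Area form. -/
def om (x y : E2) : ℝ := x 0 * y 1 - x 1 * y 0

lemma toEuc_apply0 (g : SL2) (v : E2) :
    toEuc g v 0 = (g : Mat2) 0 0 * v 0 + (g : Mat2) 0 1 * v 1 := by
  rw [toEuc, Matrix.ofLp_toEuclideanCLM]
  simp [Matrix.mulVec, dotProduct, Fin.sum_univ_two]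

lemma toEuc_apply1 (g : SL2) (v : E2) :
    toEuc g v 1 = (g : Mat2) 1 0 * v 0 + (g : Mat2) 1 1 * v 1 := by
  rw [toEuc, Matrix.ofLp_toEuclideanCLM]
  simp [Matrix.mulVec, dotProduct, Fin.sum_univ_two]

lemma toEuc_mul (g h : SL2) (v : E2) : toEuc (g * h) v = toEuc g (toEuc h v) := by
  simp [toEuc, map_mul]

lemma toEuc_one (v : E2) : toEuc 1 v = v := by
  simp [toEuc]

lemma toEuc_ne_zero (g : SL2) {v : E2} (hv : v ≠ 0) : toEuc g v ≠ 0 := by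
  intro h
  exact hv (toEuc_injective g (by rw [h, map_zero]))

lemma det_eq (g : SL2) : (g : Mat2) 0 0 * (g : Mat2) 1 1 - (g : Mat2) 0 1 * (g : Mat2) 1 0 = 1 := by
  have := g.det_coe
  rwa [Matrix.det_fin_two] at this

lemma om_toEuc (g : SL2) (x y : E2) : om (toEuc g x) (toEuc g y) = om x y := by
  have := det_eq g
  simp only [om, toEuc_apply0, toEuc_apply1]
  linear_combination (x 0 * y 1 - x 1 * y 0) * this

lemma normsq (x : E2) : ‖x‖ ^ 2 = x 0 ^ 2 + x 1 ^ 2 := by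
  simp [EuclideanSpace.norm_sq_eq, Fin.sum_univ_two]

lemma abs_om_le (x y : E2) : |om x y| ≤ ‖x‖ * ‖y‖ := by
  apply abs_le_of_sq_le_sq _ (by positivity)
  rw [mul_pow, normsq, normsq]
  simp only [om]
  nlinarith [sq_nonneg (x 0 * y 0 + x 1 * y 1)]

lemma opNorm_eq (g : SL2) : opNorm (g : Mat2) = ‖toEuc g‖ := rfl

lemma norm_mul_le' (g h : SL2) : ‖toEuc (g * h)‖ ≤ ‖toEuc g‖ * ‖toEuc h‖ := by
  have : toEuc (g * h) = (toEuc g).comp (toEuc h) := by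
    ext1 v; rw [toEuc_mul]; rfl
  rw [this]
  exact ContinuousLinearMap.opNorm_comp_le _ _

def e1 : E2 := !₂[1, 0]
def e2 : E2 := !₂[0, 1]

lemma norm_e1 : ‖e1‖ = 1 := by
  have := normsq e1
  have h0 := norm_nonneg e1
  have h1 : e1 0 ^ 2 + e1 1 ^ 2 = 1 := by simp [e1]
  nlinarith
lemma norm_e2 : ‖e2‖ = 1 := by
  have := normsq e2
  have h0 := norm_nonneg e2
  have h1 : e2 0 ^ 2 + e2 1 ^ 2 = 1 := by simp [e2]
  nlinarith

lemma one_le_norm (g : SL2) : 1 ≤ ‖toEuc g‖ := by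
  have h : om (toEuc g e1) (toEuc g e2) = 1 := by
    rw [om_toEuc]; simp [om, e1, e2]
  have h1 := abs_om_le (toEuc g e1) (toEuc g e2)
  rw [h] at h1
  have a := (toEuc g).le_opNorm e1
  have b := (toEuc g).le_opNorm e2
  rw [norm_e1] at a; rw [norm_e2] at b
  simp at a b h1
  have : 1 ≤ ‖toEuc g‖ * ‖toEuc g‖ := h1.trans (mul_le_mul a b (norm_nonneg _) (norm_nonneg _))
  nlinarith [norm_nonneg (toEuc g)]

/-! ### words -/

def prodW (A : Fin κ → SL2) : List (Fin κ) → SL2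
  | [] => 1
  | i :: w => prodW A w * A i

lemma prodW_append (A : Fin κ → SL2) (w w' : List (Fin κ)) :
    prodW A (w ++ w') = prodW A w' * prodW A w := by
  induction w with
  | nil => simp [prodW]
  | cons i w ih => simp [prodW, ih, mul_assoc]

lemma prodW_eq (A : Fin κ → SL2) (l : List (Fin κ)) :
    prodW A l = (l.map A).reverse.prod := by
  induction l with
  | nil => simp [prodW]
  | cons i w ih => simp [prodW, ih]

lemma wordProd_eq (A : Fin κ → SL2) {n : ℕ} (w : Fin n → Fin κ) :
    wordProd A w = prodW A (List.ofFn w) := by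
  rw [prodW_eq, wordProd, List.map_ofFn]; rfl

def Ex (p : Fin κ → ℝ) : ℕ → (List (Fin κ) → ℝ) → ℝ
  | 0, F => F []
  | n + 1, F => ∑ i, p i * Ex p n (fun w => F (i :: w))

lemma Ex_eq_sum (p : Fin κ → ℝ) (n : ℕ) (F : List (Fin κ) → ℝ) :
    Ex p n F = ∑ w : Fin n → Fin κ, (∏ i, p (w i)) * F (List.ofFn w) := by
  induction n generalizing F with
  | zero => simp [Ex]
  | succ n ih =>
    rw [Ex, ← (Fin.consEquiv (fun _ => Fin κ)).sum_comp, Fintype.sum_prod_type]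
    refine Finset.sum_congr rfl fun i _ => ?_
    rw [ih, Finset.mul_sum]
    refine Finset.sum_congr rfl fun w _ => ?_
    simp [Fin.consEquiv, Fin.prod_univ_succ, List.ofFn_succ, mul_assoc]

lemma Ex_mono' {p : Fin κ → ℝ} (hp : ∀ i, 0 < p i) (n : ℕ) {F G : List (Fin κ) → ℝ}
    (h : ∀ w, w.length = n → F w ≤ G w) : Ex p n F ≤ Ex p n G := by
  induction n generalizing F G with
  | zero => exact h [] rfl
  | succ n ih =>
    refine Finset.sum_le_sum fun i _ => mul_le_mul_of_nonneg_left ?_ (hp i).le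
    exact ih fun w hw => h _ (by simp [hw])

lemma Ex_mono {p : Fin κ → ℝ} (hp : ∀ i, 0 < p i) (n : ℕ) {F G : List (Fin κ) → ℝ}
    (h : ∀ w, F w ≤ G w) : Ex p n F ≤ Ex p n G := Ex_mono' hp n fun w _ => h w

lemma Ex_const {p : Fin κ → ℝ} (hp1 : ∑ i, p i = 1) (n : ℕ) (c : ℝ) :
    Ex p n (fun _ => c) = c := by
  induction n with
  | zero => rfl
  | succ n ih => simp only [Ex, ih, ← Finset.sum_mul, hp1, one_mul]

lemma Ex_add (p : Fin κ → ℝ) (n : ℕ) (F G : List (Fin κ) → ℝ) :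
    Ex p n (fun w => F w + G w) = Ex p n F + Ex p n G := by
  induction n generalizing F G with
  | zero => rfl
  | succ n ih => simp only [Ex, ih, mul_add, Finset.sum_add_distrib]

lemma Ex_mul (p : Fin κ → ℝ) (n : ℕ) (c : ℝ) (F : List (Fin κ) → ℝ) :
    Ex p n (fun w => c * F w) = c * Ex p n F := by
  induction n generalizing F with
  | zero => rfl
  | succ n ih =>
    simp only [Ex, ih, Finset.mul_sum]
    exact Finset.sum_congr rfl fun i _ => by ring

lemma Ex_len (p : Fin κ → ℝ) (m n : ℕ) (F : List (Fin κ) → ℝ) :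
    Ex p (m + n) F = Ex p m (fun w => Ex p n (fun w' => F (w ++ w'))) := by
  induction m generalizing F with
  | zero => simp [Ex]
  | succ m ih => 
    rw [Nat.succ_add]
    simp only [Ex, ih, List.cons_append]

/-- Expected log norm. -/
def U (p : Fin κ → ℝ) (A : Fin κ → SL2) (n : ℕ) : ℝ :=
  Ex p n (fun w => Real.log ‖toEuc (prodW A w)‖)

lemma lyap_eq (p : Fin κ → ℝ) (A : Fin κ → SL2) :
    lyapLC p A = ⨅ n : {m : ℕ // 0 < m}, (((n : ℕ) : ℝ))⁻¹ * U p A n := by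
  unfold lyapLC U
  congr 1; ext n
  rw [Ex_eq_sum]
  simp only [wordProd_eq, opNorm_eq]


lemma U_nonneg {p : Fin κ → ℝ} (hp : ∀ i, 0 < p i) (hp1 : ∑ i, p i = 1)
    (A : Fin κ → SL2) (n : ℕ) : 0 ≤ U p A n := by
  rw [← Ex_const hp1 n 0]
  exact Ex_mono hp n fun w => Real.log_nonneg (one_le_norm _)

lemma U_sub {p : Fin κ → ℝ} (hp : ∀ i, 0 < p i) (hp1 : ∑ i, p i = 1)
    (A : Fin κ → SL2) : Subadditive (U p A) := by
  intro m n
  have h1 : U p A m + U p A n = Ex p m (fun w => Ex p n (fun w' =>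
      Real.log ‖toEuc (prodW A w)‖ + Real.log ‖toEuc (prodW A w')‖)) := by
    simp only [Ex_add, Ex_const hp1]; rfl
  rw [h1, U, Ex_len]
  refine Ex_mono hp m fun w => Ex_mono hp n fun w' => ?_
  have a := one_le_norm (prodW A w)
  have b := one_le_norm (prodW A w')
  rw [← Real.log_mul (by positivity) (by positivity), prodW_append, mul_comm ‖toEuc (prodW A w)‖]
  exact Real.log_le_log (by linarith [one_le_norm (prodW A w' * prodW A w)]) (norm_mul_le' _ _)

lemma U_bdd {p : Fin κ → ℝ} (hp : ∀ i, 0 < p i) (hp1 : ∑ i, p i = 1)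
    (A : Fin κ → SL2) : BddBelow (Set.range fun n : ℕ => U p A n / n) :=
  ⟨0, by rintro _ ⟨n, rfl⟩; exact div_nonneg (U_nonneg hp hp1 A n) (Nat.cast_nonneg n)⟩

lemma lyap_bdd {p : Fin κ → ℝ} (hp : ∀ i, 0 < p i) (hp1 : ∑ i, p i = 1)
    (A : Fin κ → SL2) :
    BddBelow (Set.range fun n : {m : ℕ // 0 < m} => (((n : ℕ) : ℝ))⁻¹ * U p A n) :=
  ⟨0, by rintro _ ⟨n, rfl⟩; exact mul_nonneg (by positivity) (U_nonneg hp hp1 A n)⟩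

lemma lyap_nonneg {p : Fin κ → ℝ} (hp : ∀ i, 0 < p i) (hp1 : ∑ i, p i = 1)
    (A : Fin κ → SL2) : 0 ≤ lyapLC p A := by
  rw [lyap_eq]
  exact Real.iInf_nonneg fun n => mul_nonneg (by positivity) (U_nonneg hp hp1 A n)

lemma lyap_le {p : Fin κ → ℝ} (hp : ∀ i, 0 < p i) (hp1 : ∑ i, p i = 1)
    (A : Fin κ → SL2) (n : ℕ) : n * lyapLC p A ≤ U p A n := by
  rcases Nat.eq_zero_or_pos n with rfl | hn
  · simpa using U_nonneg hp hp1 A 0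
  · have := ciInf_le (lyap_bdd hp hp1 A) ⟨n, hn⟩
    rw [← lyap_eq] at this
    have hn' : (0 : ℝ) < n := by exact_mod_cast hn
    simp only at this
    rwa [inv_mul_eq_div, le_div_iff₀ hn', mul_comm] at this

lemma U_mul {p : Fin κ → ℝ} (hp : ∀ i, 0 < p i) (hp1 : ∑ i, p i = 1)
    (A : Fin κ → SL2) (n k : ℕ) : U p A (k * n) ≤ k * U p A n + U p A 0 := by
  induction k with
  | zero => simp
  | succ k ih =>
    rw [Nat.succ_mul]
    have := U_sub hp hp1 A (k * n) n
    push_cast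
    linarith

/-- Criterion for lower bounds on the exponent. -/
lemma le_lyap {p : Fin κ → ℝ} (hp : ∀ i, 0 < p i) (hp1 : ∑ i, p i = 1)
    (A : Fin κ → SL2) (N : ℕ) (hN : 0 < N) (c C : ℝ)
    (h : ∀ k : ℕ, (k * N : ℕ) * c - C ≤ U p A (k * N)) : c ≤ lyapLC p A := by
  have : Nonempty {m : ℕ // 0 < m} := ⟨⟨1, one_pos⟩⟩
  rw [lyap_eq]
  refine le_ciInf fun ⟨n, hn⟩ => ?_
  have hn' : (0 : ℝ) < n := by exact_mod_cast hn
  have hN' : (0 : ℝ) < N := by exact_mod_cast hN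
  simp only
  rw [inv_mul_eq_div, le_div_iff₀ hn']
  by_contra hlt
  push Not at hlt
  obtain ⟨k, hk⟩ := exists_nat_gt ((C + U p A 0) / ((c * n - U p A n) * N))
  rw [div_lt_iff₀ (by nlinarith)] at hk
  have h1 := h (k * n)
  have h2 := U_mul hp hp1 A n (k * N)
  rw [show k * n * N = k * N * n by ring] at h1
  push_cast at h1 h2
  nlinarith

end BV

namespace BV

variable {κ : ℕ}

/-- Expected log growth of a vector. -/
def H (p : Fin κ → ℝ) (A : Fin κ → SL2) (n : ℕ) (v : E2) : ℝ :=
  Ex p n (fun w => Real.log ‖toEuc (prodW A w) v‖)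

lemma H_zero (p : Fin κ → ℝ) (A : Fin κ → SL2) (v : E2) : H p A 0 v = Real.log ‖v‖ := by
  simp [H, Ex, prodW, toEuc_one]

lemma H_succ (p : Fin κ → ℝ) (A : Fin κ → SL2) (n : ℕ) (v : E2) :
    H p A (n + 1) v = ∑ i, p i * H p A n (toEuc (A i) v) := by
  simp only [H, Ex, prodW, toEuc_mul]

lemma H_one (p : Fin κ → ℝ) (A : Fin κ → SL2) (v : E2) :
    H p A 1 v = ∑ i, p i * Real.log ‖toEuc (A i) v‖ := by
  simp only [H_succ, H_zero]

lemma H_add (p : Fin κ → ℝ) (A : Fin κ → SL2) (m n : ℕ) (v : E2) :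
    H p A (m + n) v = Ex p m (fun w => H p A n (toEuc (prodW A w) v)) := by
  simp only [H, Ex_len, prodW_append, toEuc_mul]

lemma H_smul {p : Fin κ → ℝ} (hp1 : ∑ i, p i = 1) (A : Fin κ → SL2) (n : ℕ) {t : ℝ} (ht : t ≠ 0)
    {v : E2} (hv : v ≠ 0) : H p A n (t • v) = Real.log |t| + H p A n v := by
  rw [← Ex_const hp1 n (Real.log |t|), H, H, ← Ex_add]
  congr 1; ext w
  rw [map_smul, norm_smul, Real.norm_eq_abs, Real.log_mul (by simpa using ht)]
  exact norm_ne_zero_iff.2 (toEuc_ne_zero _ hv)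

/-- lower bound passes from unit vectors to all. -/
lemma H_ge_of_unit {p : Fin κ → ℝ} (hp1 : ∑ i, p i = 1) (A : Fin κ → SL2) (n : ℕ) {c : ℝ}
    (h : ∀ v : E2, ‖v‖ = 1 → c ≤ H p A n v) {v : E2} (hv : v ≠ 0) :
    Real.log ‖v‖ + c ≤ H p A n v := by
  have hn : ‖v‖ ≠ 0 := norm_ne_zero_iff.2 hv
  have hu : ‖(‖v‖⁻¹ • v)‖ = 1 := by rw [norm_smul]; simp [hn]
  have h1 := h _ hu
  rw [H_smul hp1 A n (inv_ne_zero hn) hv, abs_inv, abs_norm, Real.log_inv] at h1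
  linarith

/-- uniform bound of the logarithmic cocycle. -/
def LB (A : Fin κ → SL2) (C : ℝ) : Prop :=
  0 ≤ C ∧ ∀ i, ‖toEuc (A i)‖ ≤ Real.exp C ∧ ∀ v : E2, v ≠ 0 →
    |Real.log ‖toEuc (A i) v‖ - Real.log ‖v‖| ≤ C

lemma exists_LB (A : Fin κ → SL2) : ∃ C, LB A C := by
  have hl : ∀ g : SL2, 0 ≤ Real.log ‖toEuc g‖ := fun g => Real.log_nonneg (one_le_norm g)
  refine ⟨∑ i, (Real.log ‖toEuc (A i)‖ + Real.log ‖toEuc (A i)⁻¹‖),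
    Finset.sum_nonneg fun i _ => add_nonneg (hl _) (hl _), fun i => ?_⟩
  have h1 : Real.log ‖toEuc (A i)‖ + Real.log ‖toEuc (A i)⁻¹‖ ≤
      ∑ i, (Real.log ‖toEuc (A i)‖ + Real.log ‖toEuc (A i)⁻¹‖) :=
    Finset.single_le_sum (f := fun i => Real.log ‖toEuc (A i)‖ + Real.log ‖toEuc (A i)⁻¹‖)
      (fun i _ => add_nonneg (hl _) (hl _)) (Finset.mem_univ i)
  have a := one_le_norm (A i)
  have b := one_le_norm (A i)⁻¹
  have la := hl (A i)
  have lb := hl (A i)⁻¹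
  constructor
  · rw [← Real.log_le_iff_le_exp (by linarith)]; linarith
  · intro v hv
    have hv' := norm_pos_iff.2 hv
    have hw' := norm_pos_iff.2 (toEuc_ne_zero (A i) hv)
    have h2 := Real.log_le_log hw' ((toEuc (A i)).le_opNorm v)
    have h3 : ‖v‖ ≤ ‖toEuc (A i)⁻¹‖ * ‖toEuc (A i) v‖ := by
      have := (toEuc (A i)⁻¹).le_opNorm (toEuc (A i) v)
      rwa [← toEuc_mul, inv_mul_cancel, toEuc_one] at this
    have h4 := Real.log_le_log hv' h3
    rw [Real.log_mul (by linarith) hv'.ne'] at h2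
    rw [Real.log_mul (by linarith) hw'.ne'] at h4
    rw [abs_le]; constructor <;> linarith

lemma LB_word {A : Fin κ → SL2} {C : ℝ} (h : LB A C) (w : List (Fin κ)) {v : E2} (hv : v ≠ 0) :
    |Real.log ‖toEuc (prodW A w) v‖ - Real.log ‖v‖| ≤ w.length * C := by
  induction w generalizing v with
  | nil => simp [prodW, toEuc_one]
  | cons i w ih =>
    have h1 := ih (toEuc_ne_zero (A i) hv)
    have h2 := (h.2 i).2 v hv
    simp only [prodW, toEuc_mul, List.length_cons]
    push_cast
    rw [abs_le] at *
    constructor <;> linarith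

lemma H_abs {p : Fin κ → ℝ} (hp : ∀ i, 0 < p i) (hp1 : ∑ i, p i = 1)
    {A : Fin κ → SL2} {C : ℝ} (h : LB A C) (n : ℕ) {v : E2} (hv : v ≠ 0) :
    |H p A n v - Real.log ‖v‖| ≤ n * C := by
  rw [abs_le]
  constructor
  · have : Ex p n (fun _ => Real.log ‖v‖ - n * C) ≤ H p A n v := Ex_mono' hp n fun w hw => by
      have := (abs_le.1 (LB_word h w hv)).1
      rw [hw] at this; linarith
    rw [Ex_const hp1] at this; linarith
  · have : H p A n v ≤ Ex p n (fun _ => Real.log ‖v‖ + n * C) := Ex_mono' hp n fun w hw => by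
      have := (abs_le.1 (LB_word h w hv)).2
      rw [hw] at this; linarith
    rw [Ex_const hp1] at this; linarith

/-! ### Triangular bound -/

/-- sum of squared inverse norms along the orbit -/
def S (A : Fin κ → SL2) (s : ℝ) : List (Fin κ) → E2 → ℝ
  | [], v => Real.exp (-s * Real.log ‖v‖)
  | i :: w, v => Real.exp (-s * Real.log ‖v‖) + S A s w (toEuc (A i) v)

lemma S_pos (A : Fin κ → SL2) (s : ℝ) (w : List (Fin κ)) (v : E2) : 0 < S A s w v := by
  induction w generalizing v with
  | nil => exact Real.exp_pos _
  | cons i w ih => exact add_pos (Real.exp_pos _) (ih _)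

def ip (x y : E2) : ℝ := x 0 * y 0 + x 1 * y 1

lemma ip_om (x y : E2) : ip x y ^ 2 + om x y ^ 2 = ‖x‖ ^ 2 * ‖y‖ ^ 2 := by
  rw [normsq, normsq, ip, om]; ring

lemma exp_neg_two_log {v : E2} (hv : v ≠ 0) : Real.exp (-2 * Real.log ‖v‖) = (‖v‖ ^ 2)⁻¹ := by
  have := norm_pos_iff.2 hv
  rw [show -2 * Real.log ‖v‖ = -(2 * Real.log ‖v‖) by ring, Real.exp_neg]
  congr 1
  rw [show 2 * Real.log ‖v‖ = ((2 : ℕ) : ℝ) * Real.log ‖v‖ by norm_num, Real.exp_nat_mul, Real.exp_log this]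

lemma ip_step {A : Fin κ → SL2} {C : ℝ} (h : LB A C) (i : Fin κ) (u : E2) {v : E2} (hv : v ≠ 0) :
    |ip (toEuc (A i) u) (toEuc (A i) v)| / ‖toEuc (A i) v‖ ^ 2 ≤ |ip u v| / ‖v‖ ^ 2 +
      |om u v| * Real.exp (2 * C) / ‖v‖ ^ 2 := by
  have hn := norm_pos_iff.2 hv
  have hn' := norm_pos_iff.2 (toEuc_ne_zero (A i) hv)
  set g := A i
  set J : E2 := !₂[-v 1, v 0] with hJ
  have hJn : ‖J‖ = ‖v‖ := by
    have h1 := normsq J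
    have h2 := normsq v
    have : ‖J‖ ^ 2 = ‖v‖ ^ 2 := by rw [h1, h2, hJ]; simp; ring
    nlinarith [norm_nonneg J]
  -- decomposition
  have key : ip (toEuc g u) (toEuc g v) * ‖v‖ ^ 2 = ip u v * ‖toEuc g v‖ ^ 2
      - om u v * ip (toEuc g J) (toEuc g v) := by
    rw [normsq, normsq]
    simp only [ip, om, toEuc_apply0, toEuc_apply1, hJ]
    simp
    ring
  have hb : |ip (toEuc g J) (toEuc g v)| ≤ ‖toEuc g J‖ * ‖toEuc g v‖ := by
    apply abs_le_of_sq_le_sq _ (by positivity)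
    rw [mul_pow, ← ip_om]; nlinarith [sq_nonneg (om (toEuc g J) (toEuc g v))]
  have hgJ : ‖toEuc g J‖ ≤ Real.exp C * ‖v‖ := by
    rw [← hJn]
    exact ((toEuc g).le_opNorm J).trans (mul_le_mul_of_nonneg_right (h.2 i).1 (norm_nonneg _))
  have hgv : ‖v‖ ≤ Real.exp C * ‖toEuc g v‖ := by
    have := (abs_le.1 ((h.2 i).2 v hv)).1
    rw [← Real.log_le_log_iff hn (by positivity), Real.log_mul (by positivity) hn'.ne', Real.log_exp]
    linarith
  have h2C : Real.exp (2 * C) = Real.exp C * Real.exp C := by rw [← Real.exp_add]; ring_nf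
  rw [← add_div, div_le_div_iff₀ (by positivity) (by positivity), ← abs_of_pos (pow_pos hn 2), ← abs_mul,
    key]
  calc |ip u v * ‖toEuc g v‖ ^ 2 - om u v * ip (toEuc g J) (toEuc g v)|
      ≤ |ip u v| * ‖toEuc g v‖ ^ 2 + |om u v| * |ip (toEuc g J) (toEuc g v)| := by
        refine (abs_sub _ _).trans ?_
        rw [abs_mul, abs_mul, abs_of_pos (pow_pos hn' 2)]
    _ ≤ |ip u v| * ‖toEuc g v‖ ^ 2 + |om u v| * ((Real.exp C * (Real.exp C * ‖toEuc g v‖)) * ‖toEuc g v‖) := by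
        gcongr
        refine hb.trans ?_
        gcongr
        exact hgJ.trans (by gcongr)
    _ = _ := by rw [h2C]; ring

lemma tri_bound {A : Fin κ → SL2} {C : ℝ} (h : LB A C) (w : List (Fin κ)) (u : E2) {v : E2}
    (hv : v ≠ 0) : ‖toEuc (prodW A w) u‖ ≤ ‖toEuc (prodW A w) v‖ *
      (|ip u v| / ‖v‖ ^ 2 + |om u v| * Real.exp (2 * C) * S A 2 w v) := by
  have hC : 1 ≤ Real.exp (2 * C) := Real.one_le_exp (by linarith [h.1])
  induction w generalizing u v with
  | nil =>
    have hn := norm_pos_iff.2 hv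
    simp only [prodW, toEuc_one, S, exp_neg_two_log hv]
    have h1 : ‖u‖ * ‖v‖ ≤ |ip u v| + |om u v| := by
      apply le_of_sq_le_sq _ (by positivity)
      rw [mul_pow, ← ip_om, add_sq, sq_abs, sq_abs]
      nlinarith [mul_nonneg (abs_nonneg (ip u v)) (abs_nonneg (om u v))]
    have h2 : ‖v‖ * (|ip u v| / ‖v‖ ^ 2 + |om u v| * Real.exp (2 * C) * (‖v‖ ^ 2)⁻¹) =
        (|ip u v| + |om u v| * Real.exp (2 * C)) / ‖v‖ := by
      field_simp
    rw [h2, le_div_iff₀ hn]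
    nlinarith [abs_nonneg (om u v)]
  | cons i w ih =>
    simp only [prodW, toEuc_mul, S, exp_neg_two_log hv]
    refine (ih (toEuc (A i) u) (toEuc_ne_zero (A i) hv)).trans ?_
    rw [om_toEuc]
    have := ip_step h i u hv
    refine mul_le_mul_of_nonneg_left ?_ (norm_nonneg _)
    rw [mul_add, ← add_assoc, ← div_eq_mul_inv]
    gcongr

lemma norm_prod_le {A : Fin κ → SL2} {C : ℝ} (h : LB A C) (w : List (Fin κ)) {v : E2}
    (hv : ‖v‖ = 1) : ‖toEuc (prodW A w)‖ ≤ ‖toEuc (prodW A w) v‖ *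
      (2 * Real.exp (2 * C) * S A 2 w v) := by
  have hv0 : v ≠ 0 := by rintro rfl; simp at hv
  have hC : 1 ≤ Real.exp (2 * C) := Real.one_le_exp (by linarith [h.1])
  have hS := S_pos A 2 w v
  have hS1 : 1 ≤ S A 2 w v := by
    cases w with
    | nil => simp [S, hv]
    | cons i w => simp [S, hv, (S_pos A 2 w _).le]
  refine ContinuousLinearMap.opNorm_le_bound _ (by positivity) fun u => ?_
  refine (tri_bound h w u hv0).trans ?_
  rw [mul_assoc ‖toEuc (prodW A w) v‖]
  refine mul_le_mul_of_nonneg_left ?_ (norm_nonneg _)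
  rw [hv]
  have h1 : |ip u v| ≤ ‖u‖ := by
    apply abs_le_of_sq_le_sq _ (by positivity)
    have := ip_om u v
    rw [hv] at this
    nlinarith [sq_nonneg (om u v)]
  have h2 := abs_om_le u v
  rw [hv, mul_one] at h2
  have h3 : 1 ≤ Real.exp (2 * C) * S A 2 w v := by nlinarith
  have h4 : |om u v| * (Real.exp (2 * C) * S A 2 w v) ≤ ‖u‖ * (Real.exp (2 * C) * S A 2 w v) := by gcongr
  have h5 : ‖u‖ * 1 ≤ ‖u‖ * (Real.exp (2 * C) * S A 2 w v) := by gcongr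
  simp only [one_pow, div_one]
  nlinarith

end BV

namespace BV

variable {κ : ℕ}

/-- Expected negative moments. -/
def Q (p : Fin κ → ℝ) (A : Fin κ → SL2) (s : ℝ) (n : ℕ) (v : E2) : ℝ :=
  Ex p n (fun w => Real.exp (-s * Real.log ‖toEuc (prodW A w) v‖))

lemma Q_zero (p : Fin κ → ℝ) (A : Fin κ → SL2) (s : ℝ) (v : E2) :
    Q p A s 0 v = Real.exp (-s * Real.log ‖v‖) := by
  simp [Q, Ex, prodW, toEuc_one]

lemma Q_succ (p : Fin κ → ℝ) (A : Fin κ → SL2) (s : ℝ) (n : ℕ) (v : E2) :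
    Q p A s (n + 1) v = ∑ i, p i * Q p A s n (toEuc (A i) v) := by
  simp only [Q, Ex, prodW, toEuc_mul]

lemma Q_add (p : Fin κ → ℝ) (A : Fin κ → SL2) (s : ℝ) (m n : ℕ) (v : E2) :
    Q p A s (m + n) v = Ex p m (fun w => Q p A s n (toEuc (prodW A w) v)) := by
  simp only [Q, Ex_len, prodW_append, toEuc_mul]

lemma Ex_S {p : Fin κ → ℝ} (hp1 : ∑ i, p i = 1) (A : Fin κ → SL2) (s : ℝ) (n : ℕ) (v : E2) :
    Ex p n (fun w => S A s w v) = ∑ j ∈ Finset.range (n + 1), Q p A s j v := by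
  induction n generalizing v with
  | zero => simp [Ex, S, Q_zero]
  | succ n ih =>
    rw [Finset.sum_range_succ', Q_zero]
    simp only [Ex, S, Ex_add, Ex_const hp1, ih, Q_succ]
    simp only [mul_add, Finset.sum_add_distrib, ← Finset.sum_mul, hp1, one_mul, Finset.mul_sum]
    rw [Finset.sum_comm, add_comm]

lemma S_two_le (A : Fin κ → SL2) {s : ℝ} (hs : 0 < s) (w : List (Fin κ)) (v : E2) {T : ℝ}
    (h : S A s w v ≤ T) : S A 2 w v ≤ (w.length + 1) * Real.exp (2 / s * Real.log T) := by
  have term : ∀ x : ℝ, Real.exp (-s * x) ≤ T → Real.exp (-2 * x) ≤ Real.exp (2 / s * Real.log T) := by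
    intro x hx
    have h1 := Real.log_le_log (Real.exp_pos _) hx
    rw [Real.log_exp] at h1
    apply Real.exp_le_exp.2
    have : 2 / s * (-s * x) ≤ 2 / s * Real.log T := by gcongr
    calc -2 * x = 2 / s * (-s * x) := by field_simp
      _ ≤ _ := this
  induction w generalizing v with
  | nil => simpa [S] using term _ h
  | cons i w ih =>
    simp only [S] at h ⊢
    have a := S_pos A s w (toEuc (A i) v)
    have b := Real.exp_pos (-s * Real.log ‖v‖)
    have h1 := term _ (show Real.exp (-s * Real.log ‖v‖) ≤ T by linarith)
    have h2 := ih _ (show S A s w (toEuc (A i) v) ≤ T by linarith)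
    simp only [List.length_cons]; push_cast
    linarith

lemma Q_block {p : Fin κ → ℝ} (hp : ∀ i, 0 < p i) (hp1 : ∑ i, p i = 1)
    {A : Fin κ → SL2} {C : ℝ} (h : LB A C) {N : ℕ} {s a : ℝ} (hs : 0 < s) (hs1 : s * (N * C) ≤ 1)
    (hN : ∀ v : E2, ‖v‖ = 1 → N * a ≤ H p A N v) {v : E2} (hv : v ≠ 0) :
    Q p A s N v ≤ Real.exp (-s * N * a + (s * (N * C)) ^ 2) * Real.exp (-s * Real.log ‖v‖) := by
  have hNv := H_ge_of_unit hp1 A N hN hv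
  have hpt : ∀ w : List (Fin κ), w.length = N → Real.exp (-s * Real.log ‖toEuc (prodW A w) v‖) ≤
      Real.exp (-s * Real.log ‖v‖) * (1 + s * Real.log ‖v‖ + (s * (N * C)) ^ 2) +
       (Real.exp (-s * Real.log ‖v‖) * -s) * Real.log ‖toEuc (prodW A w) v‖ := by
    intro w hw
    have h1 := LB_word h w hv
    rw [hw] at h1
    set z := Real.log ‖toEuc (prodW A w) v‖ - Real.log ‖v‖ with hz
    have h2 : |-s * z| ≤ s * (N * C) := by
      rw [abs_mul, abs_neg, abs_of_pos hs]; gcongr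
    have h3 := Real.abs_exp_sub_one_sub_id_le (h2.trans hs1)
    have h4 : (-s * z) ^ 2 ≤ (s * (N * C)) ^ 2 := by
      rw [← sq_abs]; gcongr
    have h5 := (abs_le.1 h3).2
    have h6 : Real.exp (-s * Real.log ‖toEuc (prodW A w) v‖) =
        Real.exp (-s * Real.log ‖v‖) * Real.exp (-s * z) := by
      rw [← Real.exp_add]; congr 1; rw [hz]; ring
    rw [h6]
    have h7 : Real.exp (-s * z) ≤ 1 + -s * z + (s * (N * C)) ^ 2 := by linarith
    calc _ ≤ Real.exp (-s * Real.log ‖v‖) * (1 + -s * z + (s * (N * C)) ^ 2) := by gcongr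
      _ = _ := by rw [hz]; ring
  have h1 := Ex_mono' hp N hpt
  rw [Ex_add, Ex_const hp1, Ex_mul] at h1
  refine h1.trans ?_
  have h2 : Real.exp (-s * Real.log ‖v‖) * (1 + s * Real.log ‖v‖ + (s * (N * C)) ^ 2) +
       (Real.exp (-s * Real.log ‖v‖) * -s) * H p A N v =
       (1 - s * (H p A N v - Real.log ‖v‖) + (s * (N * C)) ^ 2) * Real.exp (-s * Real.log ‖v‖) := by
    ring
  change _ + _ * H p A N v ≤ _
  rw [h2]
  gcongr
  have h3 := Real.add_one_le_exp (-s * N * a + (s * (N * C)) ^ 2)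
  have h4 : s * (N * a) ≤ s * (H p A N v - Real.log ‖v‖) := by
    apply mul_le_mul_of_nonneg_left _ hs.le; linarith
  linarith

lemma Q_bound {p : Fin κ → ℝ} (hp : ∀ i, 0 < p i) (hp1 : ∑ i, p i = 1)
    {A : Fin κ → SL2} {C : ℝ} (h : LB A C) {N : ℕ} (hN0 : 0 < N) {s a c : ℝ} (hs : 0 < s)
    (hs1 : s * (N * C) ≤ 1) (hc : 0 ≤ c) (hac : -a + s * N * C ^ 2 ≤ c)
    (hN : ∀ v : E2, ‖v‖ = 1 → N * a ≤ H p A N v) (j : ℕ) {v : E2} (hv : v ≠ 0) :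
    Q p A s j v ≤ Real.exp (s * (N * C) + s * j * c) * Real.exp (-s * Real.log ‖v‖) := by
  induction j using Nat.strong_induction_on generalizing v with
  | _ j ih =>
    by_cases hj : j < N
    · rw [← Real.exp_add, ← Ex_const hp1 j (Real.exp _)]
      refine Ex_mono' hp j fun w hw => ?_
      apply Real.exp_le_exp.2
      have h1 := (abs_le.1 (LB_word h w hv)).1
      rw [hw] at h1
      have hjN : (j : ℝ) * C ≤ N * C := by
        have : (j : ℝ) ≤ N := by exact_mod_cast hj.le
        exact mul_le_mul_of_nonneg_right this h.1
      have h2 : s * (Real.log ‖v‖ - Real.log ‖toEuc (prodW A w) v‖) ≤ s * (N * C) := by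
        gcongr; linarith
      have h3 : 0 ≤ s * j * c := by positivity
      linarith
    · push Not at hj
      obtain ⟨k, rfl⟩ := Nat.exists_eq_add_of_le hj
      rw [Q_add]
      have h1 : Ex p N (fun w => Q p A s k (toEuc (prodW A w) v)) ≤
          Ex p N (fun w => Real.exp (s * (N * C) + s * k * c) *
            Real.exp (-s * Real.log ‖toEuc (prodW A w) v‖)) :=
        Ex_mono hp N fun w => ih k (by omega) (toEuc_ne_zero _ hv)
      refine h1.trans ?_
      rw [Ex_mul]
      change _ * Q p A s N v ≤ _
      refine (mul_le_mul_of_nonneg_left (Q_block hp hp1 h hs hs1 hN hv) (Real.exp_pos _).le).trans ?_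
      rw [← mul_assoc, ← Real.exp_add]
      refine mul_le_mul_of_nonneg_right (Real.exp_le_exp.2 ?_) (Real.exp_pos _).le
      have h2 : s * N * (-a + s * N * C ^ 2) ≤ s * N * c := by gcongr
      push_cast
      nlinarith

lemma U_le {p : Fin κ → ℝ} (hp : ∀ i, 0 < p i) (hp1 : ∑ i, p i = 1)
    {A : Fin κ → SL2} {C : ℝ} (h : LB A C) {N : ℕ} (hN0 : 0 < N) {s a c : ℝ} (hs : 0 < s)
    (hs1 : s * (N * C) ≤ 1) (hc : 0 ≤ c) (hac : -a + s * N * C ^ 2 ≤ c)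
    (hN : ∀ v : E2, ‖v‖ = 1 → N * a ≤ H p A N v) (n : ℕ) {v : E2} (hv : ‖v‖ = 1) :
    U p A n ≤ Real.log (2 * Real.exp (2 * C)) + H p A n v + Real.log (n + 1) +
      2 / s * (Real.log (n + 1) + s * (N * C) + s * n * c) := by
  have hv0 : v ≠ 0 := by rintro rfl; simp at hv
  set m : ℝ := (n + 1) * Real.exp (s * (N * C) + s * n * c) with hm
  have hmpos : 0 < m := by positivity
  have hES : Ex p n (fun w => S A s w v) ≤ m := by
    rw [Ex_S hp1]
    have : ∀ j ∈ Finset.range (n + 1), Q p A s j v ≤ Real.exp (s * (N * C) + s * n * c) := by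
      intro j hj
      have hjn : (j : ℝ) ≤ n := by exact_mod_cast Nat.lt_succ_iff.1 (Finset.mem_range.1 hj)
      refine (Q_bound hp hp1 h hN0 hs hs1 hc hac hN j hv0).trans ?_
      rw [hv]; simp only [Real.log_one, mul_zero, Real.exp_zero, mul_one]
      gcongr
    refine (Finset.sum_le_card_nsmul _ _ _ this).trans ?_
    simp [hm]
  have hpt : ∀ w : List (Fin κ), w.length = n → Real.log ‖toEuc (prodW A w)‖ ≤
      (Real.log (2 * Real.exp (2 * C)) + Real.log (n + 1) + 2 / s * (Real.log m - 1)) +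
      (Real.log ‖toEuc (prodW A w) v‖ + (2 / s * m⁻¹) * S A s w v) := by
    intro w hw
    have hS := S_pos A s w v
    have hS2 := S_pos A 2 w v
    have h0 := norm_pos_iff.2 (toEuc_ne_zero (prodW A w) hv0)
    have h1 := Real.log_le_log (by linarith [one_le_norm (prodW A w)]) (norm_prod_le h w hv)
    rw [Real.log_mul h0.ne' (by positivity), Real.log_mul (by positivity) hS2.ne'] at h1
    have h2 := Real.log_le_log hS2 (S_two_le A hs w v le_rfl)
    rw [Real.log_mul (by positivity) (by positivity), Real.log_exp, hw] at h2
    have h3 := Real.log_le_sub_one_of_pos (div_pos hS hmpos)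
    rw [Real.log_div hS.ne' hmpos.ne'] at h3
    have h4 : 2 / s * Real.log (S A s w v) ≤ 2 / s * (Real.log m - 1 + S A s w v / m) := by
      gcongr; linarith
    have h5 : 2 / s * (Real.log m - 1 + S A s w v / m) =
      2 / s * (Real.log m - 1) + (2 / s * m⁻¹) * S A s w v := by ring
    linarith
  have h1 := Ex_mono' hp n hpt
  rw [Ex_add, Ex_const hp1, Ex_add, Ex_mul] at h1
  change U p A n ≤ _ + (H p A n v + _) at h1
  have h2 : 2 / s * m⁻¹ * Ex p n (fun w => S A s w v) ≤ 2 / s * m⁻¹ * m := by gcongr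
  have h3 : 2 / s * m⁻¹ * m = 2 / s := by field_simp
  have h4 : Real.log m = Real.log (n + 1) + (s * (N * C) + s * n * c) := by
    rw [hm, Real.log_mul (by positivity) (by positivity), Real.log_exp]
  rw [h4] at h1
  have h5 : 2 / s * (Real.log (n + 1) + (s * (N * C) + s * n * c) - 1) =
    2 / s * (Real.log (n + 1) + s * (N * C) + s * n * c) - 2 / s := by ring
  linarith

lemma lin_log {d K0 K1 : ℝ} (hK1 : 0 ≤ K1) (h : ∀ n : ℕ, n * d ≤ K0 + K1 * Real.log (n + 1)) :
    d ≤ 0 := by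
  by_contra hd
  push Not at hd
  obtain ⟨k, hk⟩ := exists_nat_gt ((|K0| + 2 * K1) / d + 1)
  have hk1 : 1 < (k : ℝ) := lt_of_le_of_lt (by
    have : 0 ≤ (|K0| + 2 * K1) / d := by positivity
    linarith) hk
  have hk2 : |K0| + 2 * K1 < k * d := by
    rw [← div_lt_iff₀ hd]; linarith
  have h1 := h (k ^ 2)
  have h2 : Real.log ((k ^ 2 : ℕ) + 1) ≤ 2 * k := by
    have a : Real.log ((k ^ 2 : ℕ) + 1) ≤ Real.log ((k + 1) ^ 2) := by
      apply Real.log_le_log (by positivity); push_cast; nlinarith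
    rw [Real.log_pow] at a
    have b := Real.log_le_sub_one_of_pos (show (0 : ℝ) < k + 1 by positivity)
    push_cast at a
    push_cast
    linarith
  have h3 : K1 * Real.log ((k ^ 2 : ℕ) + 1) ≤ K1 * (2 * k) := by gcongr
  push_cast at h1 h3
  have h4 := le_abs_self K0
  have h5 : (|K0| + 2 * K1) * k < k * d * k := by gcongr
  nlinarith [abs_nonneg K0]

/-- `L ≤ |ℓ|`. -/
lemma lyap_le_abs {p : Fin κ → ℝ} (hp : ∀ i, 0 < p i) (hp1 : ∑ i, p i = 1)
    (A : Fin κ → SL2) (l : ℝ)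
    (h1 : ∀ ε > 0, ∃ N : ℕ, 0 < N ∧ ∀ v : E2, ‖v‖ = 1 → N * (l - ε) ≤ H p A N v)
    (h2 : ∀ n : ℕ, ∃ v : E2, ‖v‖ = 1 ∧ H p A n v ≤ n * l) : lyapLC p A ≤ |l| := by
  obtain ⟨C, hC⟩ := exists_LB A
  have hC0 := hC.1
  apply le_of_forall_pos_le_add
  intro η hη
  obtain ⟨N, hN0, hN⟩ := h1 (η / 4) (by positivity)
  have hN' : (0 : ℝ) < N := by exact_mod_cast hN0
  obtain ⟨s, hs, hs1, hs2⟩ : ∃ s : ℝ, 0 < s ∧ s * (N * C) ≤ 1 ∧ s * N * C ^ 2 ≤ η / 4 := by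
    refine ⟨min (1 / (N * C + 1)) (η / 4 / (N * C ^ 2 + 1)), by positivity, ?_, ?_⟩
    · calc _ ≤ 1 / (N * C + 1) * (N * C) := by gcongr; exact min_le_left _ _
        _ ≤ 1 := by rw [div_mul_eq_mul_div, div_le_one (by positivity)]; linarith
    · calc _ ≤ η / 4 / (N * C ^ 2 + 1) * N * C ^ 2 := by gcongr; exact min_le_right _ _
        _ ≤ η / 4 := by
          rw [mul_assoc, div_mul_eq_mul_div, div_le_iff₀ (by positivity)]
          nlinarith
  set c : ℝ := max 0 (-l) + η / 2 with hc
  have hm0 := le_max_left 0 (-l)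
  have hm1 := le_max_right 0 (-l)
  have key : lyapLC p A - l - 2 * c ≤ 0 := by
    refine lin_log (K0 := Real.log (2 * Real.exp (2 * C)) + 2 / s * (s * (N * C)))
      (K1 := 1 + 2 / s) (by positivity) fun n => ?_
    obtain ⟨v, hv, hvn⟩ := h2 n
    have h3 := U_le hp hp1 hC hN0 hs hs1 (c := c) (by positivity) (by linarith) hN n hv
    have h4 := lyap_le hp hp1 A n
    have h5 : 2 / s * (Real.log (n + 1) + s * (N * C) + s * n * c) =
      2 / s * Real.log (n + 1) + 2 / s * (s * (N * C)) + n * (2 * c) := by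
      field_simp
    linarith
  have : l + 2 * max 0 (-l) = |l| := by
    rcases le_total 0 l with h | h
    · rw [max_eq_left (by linarith), abs_of_nonneg h]; ring
    · rw [max_eq_right (by linarith), abs_of_nonpos h]; ring
  linarith

end BV

namespace BV

open Filter Topology

variable {κ : ℕ}

lemma continuous_entry (i j : Fin 2) : Continuous (fun g : SL2 => (g : Mat2) i j) := by
  have : Continuous (fun g : SL2 => (g : Mat2)) := continuous_induced_dom
  exact (continuous_apply j).comp ((continuous_apply i).comp this)

lemma toEuc_eq (g : SL2) (v : E2) : toEuc g v = WithLp.toLp 2 (fun k : Fin 2 =>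
    (g : Mat2) k 0 * v 0 + (g : Mat2) k 1 * v 1) := by
  ext k
  fin_cases k
  · exact toEuc_apply0 g v
  · exact toEuc_apply1 g v

lemma continuous_coord (k : Fin 2) : Continuous (fun v : E2 => v k) :=
  (continuous_apply k).comp (PiLp.continuous_ofLp 2 _)

lemma continuous_toEuc : Continuous (fun q : SL2 × E2 => toEuc q.1 q.2) := by
  simp only [toEuc_eq]
  refine (PiLp.continuous_toLp 2 _).comp (continuous_pi fun k => ?_)
  have a := fun l => (continuous_entry k l).comp (continuous_fst (X := SL2) (Y := E2))
  have b := fun l => (continuous_coord l).comp (continuous_snd (X := SL2) (Y := E2))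
  exact ((a 0).mul (b 0)).add ((a 1).mul (b 1))

lemma tendsto_H_aux {α : Type*} {l : Filter α} {p : Fin κ → ℝ} {n : ℕ} {A : Fin κ → SL2} {v : E2}
    (h : ContinuousAt (fun q : (Fin κ → SL2) × E2 => H p q.1 n q.2) (A, v))
    {f : α → Fin κ → SL2} {g : α → E2} (hfg : Tendsto (fun x => (f x, g x)) l (𝓝 (A, v))) :
    Tendsto (fun x => H p (f x) n (g x)) l (𝓝 (H p A n v)) := by
  have := Tendsto.comp h hfg
  exact this

lemma continuousAt_H (p : Fin κ → ℝ) (n : ℕ) (A : Fin κ → SL2) {v : E2} (hv : v ≠ 0) :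
    ContinuousAt (fun q : (Fin κ → SL2) × E2 => H p q.1 n q.2) (A, v) := by
  induction n generalizing v with
  | zero =>
    simp only [H_zero]
    exact (continuous_snd.norm.continuousAt).log (norm_ne_zero_iff.2 hv)
  | succ n ih =>
    simp only [H_succ]
    refine tendsto_finsetSum _ fun i _ => ?_
    refine Tendsto.const_mul (p i) ?_
    have hg : Continuous (fun q : (Fin κ → SL2) × E2 => (q.1, toEuc (q.1 i) q.2)) := by
      have k1 : Continuous (fun q : (Fin κ → SL2) × E2 => q.1 i) :=
        (continuous_apply i).comp continuous_fst
      have k2 : Continuous (fun q : (Fin κ → SL2) × E2 => (q.1 i, q.2)) := k1.prodMk continuous_snd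
      have k3 := continuous_toEuc.comp k2
      exact continuous_fst.prodMk k3
    have h2 : Tendsto (fun q : (Fin κ → SL2) × E2 => (q.1, toEuc (q.1 i) q.2)) (𝓝 (A, v))
        (𝓝 (A, toEuc (A i) v)) := hg.tendsto (A, v)
    have h3 := tendsto_H_aux (ih (toEuc_ne_zero (A i) hv)) h2
    exact h3

lemma continuous_om : Continuous (fun q : E2 × E2 => om q.1 q.2) := by
  unfold om
  have a := fun l => (continuous_coord l).comp (continuous_fst (X := E2) (Y := E2))
  have b := fun l => (continuous_coord l).comp (continuous_snd (X := E2) (Y := E2))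
  exact ((a 0).mul (b 1)).sub ((a 1).mul (b 0))

lemma ne_zero_of_unit {v : E2} (hv : ‖v‖ = 1) : v ≠ 0 := by rintro rfl; simp at hv

lemma exists_min (p : Fin κ → ℝ) (A : Fin κ → SL2) (n : ℕ) :
    ∃ v : E2, ‖v‖ = 1 ∧ ∀ u : E2, ‖u‖ = 1 → H p A n v ≤ H p A n u := by
  have hc : ContinuousOn (H p A n) (Metric.sphere (0 : E2) 1) := by
    intro v hv
    have h := continuousAt_H p n A (ne_zero_of_unit (mem_sphere_zero_iff_norm.1 hv))
    have h2 : ContinuousAt (fun u : E2 => (A, u)) v := by fun_prop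
    exact (tendsto_H_aux h h2.tendsto).mono_left nhdsWithin_le_nhds
  obtain ⟨v, hv, hm⟩ := (isCompact_sphere (0 : E2) 1).exists_isMinOn
    ⟨e1, mem_sphere_zero_iff_norm.2 norm_e1⟩ hc
  exact ⟨v, mem_sphere_zero_iff_norm.1 hv, fun u hu => hm (mem_sphere_zero_iff_norm.2 hu)⟩

lemma om_le_exp {p : Fin κ → ℝ} (hp : ∀ i, 0 < p i) (hp1 : ∑ i, p i = 1)
    (A : Fin κ → SL2) (n : ℕ) (x y : E2) :
    |om x y| ≤ Real.exp (H p A n x + H p A n y) := by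
  by_cases h : om x y = 0
  · rw [h, abs_zero]; exact (Real.exp_pos _).le
  rw [← Real.log_le_iff_le_exp (abs_pos.2 h), ← Ex_const hp1 n (Real.log _), H, H, ← Ex_add]
  refine Ex_mono hp n fun w => ?_
  set g := prodW A w
  have h1 := abs_om_le (toEuc g x) (toEuc g y)
  rw [om_toEuc] at h1
  have h0 := abs_pos.2 h
  have hx : ‖toEuc g x‖ ≠ 0 := by intro h'; rw [h'] at h1; linarith
  have hy : ‖toEuc g y‖ ≠ 0 := by intro h'; rw [h'] at h1; linarith
  rw [← Real.log_mul hx hy]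
  exact Real.log_le_log h0 h1

lemma H_succ_ge {p : Fin κ → ℝ} (hp : ∀ i, 0 < p i) (hp1 : ∑ i, p i = 1)
    (A : Fin κ → SL2) (m n : ℕ) {c : ℝ} (h : ∀ v : E2, ‖v‖ = 1 → c ≤ H p A n v) {v : E2}
    (hv : v ≠ 0) : H p A m v + c ≤ H p A (m + n) v := by
  rw [H_add, ← Ex_const hp1 m c, H, ← Ex_add]
  exact Ex_mono hp m fun w => H_ge_of_unit hp1 A n h (toEuc_ne_zero _ hv)

lemma dichotomy {p : Fin κ → ℝ} (hp : ∀ i, 0 < p i) (hp1 : ∑ i, p i = 1)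
    (A : Fin κ → SL2) :
    (∀ ε > 0, ∃ N : ℕ, 0 < N ∧ ∀ v : E2, ‖v‖ = 1 → N * (lyapLC p A - ε) ≤ H p A N v) ∨
    ∃ c < 0, c ≤ -lyapLC p A ∧ ∀ ε > 0, ∃ v : E2, ‖v‖ = 1 ∧
      (∀ i, om (toEuc (A i) v) v = 0) ∧ H p A 1 v ≤ c + ε := by
  obtain ⟨C, hC⟩ := exists_LB A
  choose V hV hmin using exists_min p A
  have hV0 := fun n => ne_zero_of_unit (hV n)
  set m : ℕ → ℝ := fun n => H p A n (V n) with hm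
  have hsup : ∀ a b, m a + m b ≤ m (a + b) := by
    intro a b
    have h1 := H_succ_ge hp hp1 A a b (hmin b) (hV0 (a + b))
    have h2 := hmin a (V (a + b)) (hV (a + b))
    simp only [hm]; linarith
  have hsub : Subadditive (fun n => -m n) := by
    intro a b; have := hsup a b; simp only; linarith
  have hbd : BddBelow (Set.range fun n : ℕ => -m n / n) := by
    refine ⟨-C, ?_⟩
    rintro _ ⟨n, rfl⟩
    rcases Nat.eq_zero_or_pos n with rfl | hn
    · simp [hC.1]
    · have hn' : (0 : ℝ) < n := by exact_mod_cast hn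
      have := (abs_le.1 (H_abs hp hp1 hC n (hV0 n))).2
      rw [hV, Real.log_one] at this
      simp only
      rw [le_div_iff₀ hn']
      simp only [hm]
      linarith
  set l : ℝ := -hsub.lim with hl
  have hle : ∀ n : ℕ, m n ≤ n * l := by
    intro n
    rcases Nat.eq_zero_or_pos n with rfl | hn
    · simp [hm, H_zero, hV]
    · have hn' : (0 : ℝ) < n := by exact_mod_cast hn
      have := hsub.lim_le_div hbd hn.ne'
      rw [le_div_iff₀ hn'] at this
      rw [hl]; linarith
  have hex : ∀ ε > 0, ∃ N : ℕ, 0 < N ∧ ∀ v : E2, ‖v‖ = 1 → N * (l - ε) ≤ H p A N v := by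
    intro ε hε
    have h1 := (hsub.tendsto_lim hbd).eventually_lt_const (show hsub.lim < hsub.lim + ε by linarith)
    obtain ⟨N, hN, hN0⟩ := (h1.and (eventually_gt_atTop 0)).exists
    refine ⟨N, hN0, fun v hv => ?_⟩
    have hn' : (0 : ℝ) < N := by exact_mod_cast hN0
    rw [div_lt_iff₀ hn'] at hN
    have := hmin N v hv
    simp only [hm] at hN
    rw [hl]; nlinarith
  have hL := lyap_le_abs hp hp1 A l hex fun n => ⟨V n, hV n, hle n⟩
  rcases le_or_gt 0 l with hl0 | hl0
  · left
    rw [abs_of_nonneg hl0] at hL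
    intro ε hε
    obtain ⟨N, hN0, hN⟩ := hex ε hε
    refine ⟨N, hN0, fun v hv => le_trans ?_ (hN v hv)⟩
    gcongr
  right
  rw [abs_of_neg hl0] at hL
  refine ⟨l, hl0, by linarith, fun ε hε => ?_⟩
  have hfreq : ∃ᶠ n in atTop, n ∈ {n : ℕ | m (n + 1) - m n ≤ l + ε} := by
    intro hcon
    obtain ⟨n0, hn0⟩ := eventually_atTop.1 hcon
    have hk : ∀ k : ℕ, m n0 + k * (l + ε) ≤ m (n0 + k) := by
      intro k
      induction k with
      | zero => simp
      | succ k ih =>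
        have := hn0 (n0 + k) (by omega)
        simp only [Set.mem_ofPred_eq, not_le] at this
        push_cast
        rw [← add_assoc]
        linarith
    obtain ⟨k, hk'⟩ := exists_nat_gt ((n0 * l - m n0) / ε)
    rw [div_lt_iff₀ hε] at hk'
    have h1 := hk k
    have h2 := hle (n0 + k)
    push_cast at h2
    linarith
  rw [frequently_mem_iff_neBot] at hfreq
  set u := Ultrafilter.of (atTop ⊓ 𝓟 {n : ℕ | m (n + 1) - m n ≤ l + ε}) with hu
  have hule : (u : Filter ℕ) ≤ atTop ⊓ 𝓟 {n : ℕ | m (n + 1) - m n ≤ l + ε} := Ultrafilter.of_le _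
  have hu1 : (u : Filter ℕ) ≤ atTop := hule.trans inf_le_left
  have hu2 : ∀ᶠ n in (u : Filter ℕ), m (n + 1) - m n ≤ l + ε :=
    le_principal_iff.1 (hule.trans inf_le_right)
  have hlim : ∀ f : ℕ → E2, (∀ n, ‖f n‖ = 1) → ∃ v : E2, ‖v‖ = 1 ∧ Tendsto f u (𝓝 v) := by
    intro f hf
    obtain ⟨v, hv, hvl⟩ := (isCompact_sphere (0 : E2) 1).ultrafilter_le_nhds (u.map f)
      (le_principal_iff.2 (Filter.mem_map.2 (Filter.univ_mem' fun n =>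
        mem_sphere_zero_iff_norm.2 (hf n))))
    exact ⟨v, mem_sphere_zero_iff_norm.1 hv, hvl⟩
  obtain ⟨v, hv, hvl⟩ := hlim (fun n => V (n + 1)) fun n => hV _
  obtain ⟨v', hv', hvl'⟩ := hlim V hV
  have hv0 := ne_zero_of_unit hv
  -- decay
  have hdecay : ∀ K : ℝ, Tendsto (fun n : ℕ => Real.exp (2 * l * n + K)) u (𝓝 0) := by
    intro K
    refine Tendsto.mono_left ?_ hu1
    refine Real.tendsto_exp_atBot.comp (tendsto_atBot_add_const_right _ _ ?_)
    exact Tendsto.const_mul_atTop_of_neg (by linarith) tendsto_natCast_atTop_atTop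
  have hzero : ∀ (f : ℕ → E2) (x : E2) (K : ℝ), Tendsto f u (𝓝 x) →
      (∀ᶠ n in (u : Filter ℕ), H p A n (f n) ≤ m n + K) → om x v' = 0 := by
    intro f x K hf hK
    have h1 : Tendsto (fun n => om (f n) (V n)) u (𝓝 (om x v')) :=
      (continuous_om.tendsto (x, v')).comp (hf.prodMk_nhds hvl')
    have h2 : Tendsto (fun n => om (f n) (V n)) u (𝓝 0) := by
      refine squeeze_zero_norm' ?_ (hdecay K)
      filter_upwards [hK] with n hn
      refine (om_le_exp hp hp1 A n (f n) (V n)).trans (Real.exp_le_exp.2 ?_)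
      have := hle n
      simp only [hm] at this hn
      linarith
    exact tendsto_nhds_unique h1 h2
  have hb1 : ∀ w : E2, ‖w‖ = 1 → -C ≤ H p A 1 w := by
    intro w hw
    have := (abs_le.1 (H_abs hp hp1 hC 1 (ne_zero_of_unit hw))).1
    rw [hw, Real.log_one] at this
    push_cast at this
    linarith
  have hvv' : om v v' = 0 := by
    refine hzero _ v (l + ε + C) hvl ?_
    filter_upwards [hu2] with n hn
    have := H_succ_ge hp hp1 A n 1 hb1 (hV0 (n + 1))
    simp only [hm] at hn ⊢
    linarith
  have hAv : ∀ i, om (toEuc (A i) v) v' = 0 := by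
    intro i
    refine hzero (fun n => toEuc (A i) (V (n + 1))) _ ((l + ε + C) / p i)
      (((toEuc (A i)).continuous.tendsto v).comp hvl) ?_
    filter_upwards [hu2] with n hn
    have h1 := H_succ p A n (V (n + 1))
    have h2 : ∀ j, 0 ≤ H p A n (toEuc (A j) (V (n + 1))) - (m n - C) := by
      intro j
      have a := H_ge_of_unit hp1 A n (hmin n) (toEuc_ne_zero (A j) (hV0 (n + 1)))
      have b := (abs_le.1 ((hC.2 j).2 _ (hV0 (n + 1)))).1
      rw [hV, Real.log_one] at b
      simp only [hm]; linarith
    have h3 := Finset.single_le_sum (f := fun j => p j *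
      (H p A n (toEuc (A j) (V (n + 1))) - (m n - C)))
      (fun j _ => mul_nonneg (hp j).le (h2 j)) (Finset.mem_univ i)
    have h4 : ∑ j, p j * (H p A n (toEuc (A j) (V (n + 1))) - (m n - C)) =
        m (n + 1) - (m n - C) := by
      simp only [Finset.sum_sub_distrib, ← Finset.sum_mul, hp1, one_mul, ← h1, mul_sub]
      simp only [hm]
    have h4' : ∑ j, p j * (H p A n (toEuc (A j) (V (n + 1))) - (m n - C)) ≤ l + ε + C := by
      rw [h4]; linarith
    have h5 := h3.trans h4'
    rw [← le_div_iff₀' (hp i)] at h5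
    linarith [hC.1]
  refine ⟨v, hv, fun i => ?_, ?_⟩
  · have a := hAv i
    set x := toEuc (A i) v
    have h0 : om x v * v' 0 = 0 := by
      have : om x v * v' 0 = om x v' * v 0 - om v v' * x 0 := by simp only [om]; ring
      rw [this, a, hvv']; ring
    have h1 : om x v * v' 1 = 0 := by
      have : om x v * v' 1 = om x v' * v 1 - om v v' * x 1 := by simp only [om]; ring
      rw [this, a, hvv']; ring
    by_contra hne
    have h0' := (mul_eq_zero.1 h0).resolve_left hne
    have h1' := (mul_eq_zero.1 h1).resolve_left hne
    have := normsq v'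
    rw [hv', h0', h1'] at this
    norm_num at this
  · have h1 : Tendsto (fun n => H p A 1 (V (n + 1))) u (𝓝 (H p A 1 v)) := by
      have h := continuousAt_H p 1 A hv0
      have h2 : Tendsto (fun n => (A, V (n + 1))) u (𝓝 (A, v)) := tendsto_const_nhds.prodMk_nhds hvl
      exact tendsto_H_aux h h2
    refine le_of_tendsto h1 ?_
    filter_upwards [hu2] with n hn
    have := H_succ_ge hp hp1 A 1 n (hmin n) (hV0 (n + 1))
    rw [add_comm 1 n] at this
    simp only [hm] at hn
    linarith

lemma lyap_ge_of_H {p : Fin κ → ℝ} (hp : ∀ i, 0 < p i) (hp1 : ∑ i, p i = 1)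
    (A : Fin κ → SL2) {N : ℕ} (hN : 0 < N) {c : ℝ}
    (h : ∀ v : E2, ‖v‖ = 1 → N * c ≤ H p A N v) : c ≤ lyapLC p A := by
  refine le_lyap hp hp1 A N hN c 0 fun k => ?_
  have h1 : (k * N : ℕ) * c ≤ H p A (k * N) e1 := by
    induction k with
    | zero => simp [H_zero, norm_e1]
    | succ k ih =>
      rw [Nat.succ_mul]
      have := H_succ_ge hp hp1 A (k * N) N h (ne_zero_of_unit norm_e1)
      push_cast at ih ⊢
      linarith
  rw [sub_zero]
  refine h1.trans (Ex_mono hp _ fun w => ?_)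
  refine Real.log_le_log (norm_pos_iff.2 (toEuc_ne_zero _ (ne_zero_of_unit norm_e1))) ?_
  have := (toEuc (prodW A w)).le_opNorm e1
  rwa [norm_e1, mul_one] at this

lemma lsc_of_uniform {p : Fin κ → ℝ} (hp : ∀ i, 0 < p i) (hp1 : ∑ i, p i = 1)
    (A : Fin κ → SL2)
    (h : ∀ ε > 0, ∃ N : ℕ, 0 < N ∧ ∀ v : E2, ‖v‖ = 1 → N * (lyapLC p A - ε) ≤ H p A N v)
    {ε : ℝ} (hε : 0 < ε) : ∀ᶠ B in 𝓝 A, lyapLC p A - ε ≤ lyapLC p B := by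
  obtain ⟨N, hN0, hN⟩ := h (ε / 2) (by positivity)
  have hn' : (0 : ℝ) < N := by exact_mod_cast hN0
  have key : ∀ᶠ B in 𝓝 A, ∀ v ∈ Metric.sphere (0 : E2) 1, N * (lyapLC p A - ε) < H p B N v := by
    refine (isCompact_sphere (0 : E2) 1).eventually_forall_of_forall_eventually fun v hv => ?_
    have hv' := mem_sphere_zero_iff_norm.1 hv
    have h1 := (continuousAt_H p N A (ne_zero_of_unit hv')).tendsto
    refine h1.eventually_const_lt (lt_of_lt_of_le ?_ (hN v hv'))
    gcongr; linarith
  filter_upwards [key] with B hB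
  exact lyap_ge_of_H hp hp1 B hN0 fun v hv => (hB v (mem_sphere_zero_iff_norm.2 hv)).le

end BV

namespace BV

open Filter Topology

variable {κ : ℕ}

/-- Explicit element of `SL2`. -/
def mk2 (a b c d : ℝ) (h : a * d - b * c = 1) : SL2 :=
  ⟨!![a, b; c, d], by rw [Matrix.det_fin_two_of]; exact h⟩

lemma mk2_00 {a b c d : ℝ} (h : a * d - b * c = 1) : (mk2 a b c d h : Mat2) 0 0 = a := rfl
lemma mk2_01 {a b c d : ℝ} (h : a * d - b * c = 1) : (mk2 a b c d h : Mat2) 0 1 = b := rfl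
lemma mk2_10 {a b c d : ℝ} (h : a * d - b * c = 1) : (mk2 a b c d h : Mat2) 1 0 = c := rfl
lemma mk2_11 {a b c d : ℝ} (h : a * d - b * c = 1) : (mk2 a b c d h : Mat2) 1 1 = d := rfl

lemma mul_entry (g h : SL2) (i j : Fin 2) :
    ((g * h : SL2) : Mat2) i j = (g : Mat2) i 0 * (h : Mat2) 0 j + (g : Mat2) i 1 * (h : Mat2) 1 j := by
  rw [Matrix.SpecialLinearGroup.coe_mul, Matrix.mul_apply, Fin.sum_univ_two]

lemma inv_coe (g : SL2) : ((g⁻¹ : SL2) : Mat2) =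
    !![(g : Mat2) 1 1, -(g : Mat2) 0 1; -(g : Mat2) 1 0, (g : Mat2) 0 0] := by
  rw [Matrix.SpecialLinearGroup.coe_inv, Matrix.adjugate_fin_two]

lemma inv_00 (g : SL2) : ((g⁻¹ : SL2) : Mat2) 0 0 = (g : Mat2) 1 1 := by rw [inv_coe]; rfl
lemma inv_01 (g : SL2) : ((g⁻¹ : SL2) : Mat2) 0 1 = -(g : Mat2) 0 1 := by rw [inv_coe]; rfl
lemma inv_10 (g : SL2) : ((g⁻¹ : SL2) : Mat2) 1 0 = -(g : Mat2) 1 0 := by rw [inv_coe]; rfl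
lemma inv_11 (g : SL2) : ((g⁻¹ : SL2) : Mat2) 1 1 = (g : Mat2) 0 0 := by rw [inv_coe]; rfl

lemma tendsto_SL {α : Type*} {l : Filter α} {f : α → Fin κ → SL2} {A : Fin κ → SL2}
    (h : ∀ i j k, Tendsto (fun x => (f x i : Mat2) j k) l (𝓝 ((A i : Mat2) j k))) :
    Tendsto f l (𝓝 A) := by
  refine tendsto_pi_nhds.2 fun i => ?_
  have hind : IsInducing (fun g : SL2 => (g : Mat2)) := ⟨rfl⟩
  rw [hind.tendsto_nhds_iff]
  exact tendsto_pi_nhds.2 fun j => tendsto_pi_nhds.2 fun k => h i j k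

lemma tendsto_entry {α : Type*} {l : Filter α} {f : α → Fin κ → SL2} {A : Fin κ → SL2}
    (h : Tendsto f l (𝓝 A)) (i : Fin κ) (j k : Fin 2) :
    Tendsto (fun x => (f x i : Mat2) j k) l (𝓝 ((A i : Mat2) j k)) :=
  ((continuous_entry j k).tendsto (A i)).comp (tendsto_pi_nhds.1 h i)

lemma continuous_prodW_apply (w : List (Fin κ)) :
    Continuous (fun q : (Fin κ → SL2) × E2 => toEuc (prodW q.1 w) q.2) := by
  induction w with
  | nil => simp only [prodW, toEuc_one]; exact continuous_snd
  | cons i w ih =>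
    simp only [prodW, toEuc_mul]
    have k1 : Continuous (fun q : (Fin κ → SL2) × E2 => q.1 i) :=
      (continuous_apply i).comp continuous_fst
    have k2 : Continuous (fun q : (Fin κ → SL2) × E2 => (q.1 i, q.2)) := k1.prodMk continuous_snd
    have k3 := continuous_toEuc.comp k2
    have k4 : Continuous (fun q : (Fin κ → SL2) × E2 => (q.1, toEuc (q.1 i) q.2)) :=
      continuous_fst.prodMk k3
    have k5 := ih.comp k4
    exact k5

lemma continuous_U (p : Fin κ → ℝ) (n : ℕ) : Continuous (fun B : Fin κ → SL2 => U p B n) := by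
  simp only [U, Ex_eq_sum]
  refine continuous_finsetSum _ fun w _ => continuous_const.mul ?_
  have h1 : Continuous (fun B : Fin κ → SL2 => toEuc (prodW B (List.ofFn w))) := by
    refine continuous_clm_apply.2 fun v => ?_
    have h2 : Continuous (fun B : Fin κ → SL2 => (B, v)) := by fun_prop
    have h3 := (continuous_prodW_apply (List.ofFn w)).comp h2
    exact h3
  exact h1.norm.log fun B => (lt_of_lt_of_le one_pos (one_le_norm _)).ne'

lemma usc {p : Fin κ → ℝ} (hp : ∀ i, 0 < p i) (hp1 : ∑ i, p i = 1) (A : Fin κ → SL2)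
    {ε : ℝ} (hε : 0 < ε) : ∀ᶠ B in 𝓝 A, lyapLC p B < lyapLC p A + ε := by
  have h : lyapLC p A < lyapLC p A + ε := by linarith
  have : Nonempty {m : ℕ // 0 < m} := ⟨⟨1, one_pos⟩⟩
  nth_rewrite 1 [lyap_eq] at h
  obtain ⟨⟨n, hn⟩, hlt⟩ := exists_lt_of_ciInf_lt h
  have hn' : (0 : ℝ) < n := by exact_mod_cast hn
  have hc : Continuous (fun B : Fin κ → SL2 => (n : ℝ)⁻¹ * U p B n) :=
    continuous_const.mul (continuous_U p n)
  filter_upwards [(hc.tendsto A).eventually_lt_const hlt] with B hB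
  refine lt_of_le_of_lt ?_ hB
  rw [← div_eq_inv_mul, le_div_iff₀ hn', mul_comm]
  exact lyap_le hp hp1 B n

lemma prodW_conj (A : Fin κ → SL2) (Q : SL2) (w : List (Fin κ)) :
    prodW (fun i => Q * A i * Q⁻¹) w = Q * prodW A w * Q⁻¹ := by
  induction w with
  | nil => simp [prodW]
  | cons i w ih => simp only [prodW, ih]; group

lemma lyap_conj_le {p : Fin κ → ℝ} (hp : ∀ i, 0 < p i) (hp1 : ∑ i, p i = 1) (A : Fin κ → SL2)
    (Q : SL2) : lyapLC p (fun i => Q * A i * Q⁻¹) ≤ lyapLC p A := by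
  refine le_lyap hp hp1 A 1 one_pos _ (Real.log ‖toEuc Q‖ + Real.log ‖toEuc Q⁻¹‖) fun k => ?_
  rw [sub_le_iff_le_add]
  refine (lyap_le hp hp1 _ _).trans ?_
  rw [← Ex_const hp1 (k * 1) (Real.log ‖toEuc Q‖ + Real.log ‖toEuc Q⁻¹‖), U, U, ← Ex_add]
  refine Ex_mono hp _ fun w => ?_
  rw [prodW_conj]
  have pos := fun g : SL2 => lt_of_lt_of_le one_pos (one_le_norm g)
  rw [← Real.log_mul (pos _).ne' (pos _).ne', ← Real.log_mul (pos _).ne'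
    (mul_pos (pos _) (pos _)).ne']
  refine Real.log_le_log (pos _) ?_
  have h1 := norm_mul_le' (Q * prodW A w) Q⁻¹
  have h2 := norm_mul_le' Q (prodW A w)
  calc _ ≤ _ := h1
    _ ≤ (‖toEuc Q‖ * ‖toEuc (prodW A w)‖) * ‖toEuc Q⁻¹‖ := by gcongr
    _ = _ := by ring

lemma lyap_conj {p : Fin κ → ℝ} (hp : ∀ i, 0 < p i) (hp1 : ∑ i, p i = 1) (A : Fin κ → SL2)
    (Q : SL2) : lyapLC p (fun i => Q * A i * Q⁻¹) = lyapLC p A := by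
  refine le_antisymm (lyap_conj_le hp hp1 A Q) ?_
  have h := lyap_conj_le hp hp1 (fun i => Q * A i * Q⁻¹) Q⁻¹
  have e : (fun i => Q⁻¹ * (Q * A i * Q⁻¹) * Q⁻¹⁻¹) = A := by funext i; group
  rwa [e] at h

lemma abs_entry_le (g : SL2) : |(g : Mat2) 1 1| ≤ ‖toEuc g‖ := by
  have h1 := (toEuc g).le_opNorm e2
  rw [norm_e2, mul_one] at h1
  have h2 := toEuc_apply1 g e2
  have h3 : (toEuc g e2) 1 = (g : Mat2) 1 1 := by rw [h2]; simp [e2]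
  rw [← h3]
  exact (PiLp.norm_apply_le (toEuc g e2) 1).trans h1

lemma lyap_ge_diag {p : Fin κ → ℝ} (hp : ∀ i, 0 < p i) (hp1 : ∑ i, p i = 1) (A : Fin κ → SL2)
    (h0 : ∀ i, (A i : Mat2) 1 1 ≠ 0)
    (h : ∀ w i, (prodW A (i :: w) : Mat2) 1 1 = (prodW A w : Mat2) 1 1 * (A i : Mat2) 1 1) :
    ∑ i, p i * Real.log |(A i : Mat2) 1 1| ≤ lyapLC p A := by
  have hne : ∀ w, (prodW A w : Mat2) 1 1 ≠ 0 := by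
    intro w
    induction w with
    | nil => simp [prodW]
    | cons i w ih => rw [h]; exact mul_ne_zero ih (h0 i)
  have hE : ∀ n : ℕ, Ex p n (fun w => Real.log |(prodW A w : Mat2) 1 1|) =
      n * ∑ i, p i * Real.log |(A i : Mat2) 1 1| := by
    intro n
    induction n with
    | zero => simp [Ex, prodW]
    | succ n ih =>
      have : ∀ i, Ex p n (fun w => Real.log |(prodW A (i :: w) : Mat2) 1 1|) =
          n * ∑ i, p i * Real.log |(A i : Mat2) 1 1| + Real.log |(A i : Mat2) 1 1| := by
        intro i
        rw [← ih]
        conv_rhs => rw [← Ex_const hp1 n (Real.log |(A i : Mat2) 1 1|), ← Ex_add]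
        congr 1
        funext w
        rw [h, abs_mul, Real.log_mul (abs_ne_zero.2 (hne w)) (abs_ne_zero.2 (h0 i))]
      simp only [Ex, this, mul_add, Finset.sum_add_distrib, ← Finset.sum_mul, hp1]
      push_cast; ring
  refine le_lyap hp hp1 A 1 one_pos _ 0 fun k => ?_
  rw [sub_zero, ← hE]
  refine Ex_mono hp _ fun w => Real.log_le_log (abs_pos.2 (hne w)) (abs_entry_le _)

lemma entry_ne {g : SL2} (h : (g : Mat2) 1 0 = 0 ∨ (g : Mat2) 0 1 = 0) : (g : Mat2) 0 0 * (g : Mat2) 1 1 = 1 := by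
  have := det_eq g
  rcases h with h | h <;> rw [h] at this <;> linarith

lemma lyap_ge_upper {p : Fin κ → ℝ} (hp : ∀ i, 0 < p i) (hp1 : ∑ i, p i = 1) (A : Fin κ → SL2)
    (hA : ∀ i, (A i : Mat2) 1 0 = 0) :
    ∑ i, p i * Real.log |(A i : Mat2) 1 1| ≤ lyapLC p A := by
  have hz : ∀ w, (prodW A w : Mat2) 1 0 = 0 := by
    intro w
    induction w with
    | nil => simp [prodW]
    | cons i w ih => simp only [prodW]; rw [mul_entry, ih, hA]; ring
  refine lyap_ge_diag hp hp1 A (fun i => right_ne_zero_of_mul_eq_one (entry_ne (Or.inl (hA i)))) ?_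
  intro w i
  simp only [prodW]
  rw [mul_entry, hz]; ring

lemma lyap_ge_lower {p : Fin κ → ℝ} (hp : ∀ i, 0 < p i) (hp1 : ∑ i, p i = 1) (A : Fin κ → SL2)
    (hA : ∀ i, (A i : Mat2) 0 1 = 0) :
    ∑ i, p i * Real.log |(A i : Mat2) 1 1| ≤ lyapLC p A := by
  refine lyap_ge_diag hp hp1 A (fun i => right_ne_zero_of_mul_eq_one (entry_ne (Or.inr (hA i)))) ?_
  intro w i
  simp only [prodW]
  rw [mul_entry, hA]; ring

end BV

namespace BV

open Filter Topology

variable {κ : ℕ}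

lemma lower_uniform {p : Fin κ → ℝ} (hp : ∀ i, 0 < p i) (hp1 : ∑ i, p i = 1) (A : Fin κ → SL2)
    (hA : ∀ i, (A i : Mat2) 0 1 = 0) (i0 : Fin κ) (h10 : (A i0 : Mat2) 1 0 = 0)
    (hne : (A i0 : Mat2) 0 0 ≠ (A i0 : Mat2) 1 1)
    (hχ : 0 < ∑ i, p i * Real.log |(A i : Mat2) 1 1|)
    (hc : ∃ i, (A i : Mat2) 1 0 ≠ 0) {ε : ℝ} (hε : 0 < ε) :
    ∀ᶠ B in 𝓝 A, ∑ i, p i * Real.log |(A i : Mat2) 1 1| - ε ≤ lyapLC p B := by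
  have hL := lyap_ge_lower hp hp1 A hA
  rcases dichotomy hp hp1 A with h | ⟨c, hc0, -, h⟩
  · filter_upwards [lsc_of_uniform hp hp1 A h hε] with B hB
    linarith
  exfalso
  obtain ⟨v, hv, hinv, hH⟩ := h (-c / 2) (by linarith)
  have h0 := hinv i0
  have e : om (toEuc (A i0) v) v =
      ((A i0 : Mat2) 0 0 - (A i0 : Mat2) 1 1) * (v 0 * v 1) := by
    simp only [om, toEuc_apply0, toEuc_apply1, h10, hA i0]; ring
  rw [e] at h0
  have h1 := (mul_eq_zero.1 h0).resolve_left (sub_ne_zero.2 hne)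
  have hn := normsq v
  rw [hv] at hn
  rcases mul_eq_zero.1 h1 with hv0 | hv1
  · rw [H_one] at hH
    have hle : ∑ i, p i * Real.log |(A i : Mat2) 1 1| ≤ ∑ i, p i * Real.log ‖toEuc (A i) v‖ := by
      refine Finset.sum_le_sum fun i _ => mul_le_mul_of_nonneg_left ?_ (hp i).le
      refine Real.log_le_log
        (abs_pos.2 (right_ne_zero_of_mul_eq_one (entry_ne (Or.inr (hA i))))) ?_
      refine abs_le_of_sq_le_sq ?_ (norm_nonneg _)
      rw [normsq, toEuc_apply0, toEuc_apply1, hA i, hv0]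
      have hv1 : v 1 ^ 2 = 1 := by rw [hv0] at hn; linarith
      have : ((A i : Mat2) 1 0 * 0 + (A i : Mat2) 1 1 * v 1) ^ 2 = (A i : Mat2) 1 1 ^ 2 := by
        linear_combination (A i : Mat2) 1 1 ^ 2 * hv1
      rw [this]
      nlinarith [sq_nonneg ((A i : Mat2) 0 0 * 0 + 0 * v 1)]
    linarith
  · obtain ⟨i, hi⟩ := hc
    have h2 := hinv i
    have e2 : om (toEuc (A i) v) v = -(A i : Mat2) 1 0 * v 0 ^ 2 := by
      simp only [om, toEuc_apply0, toEuc_apply1, hA i, hv1]; ring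
    rw [hv1] at hn
    have hv0 : v 0 ^ 2 = 1 := by linarith
    rw [e2, hv0] at h2
    apply hi; linarith

lemma tendsto_chi {α : Type*} {l : Filter α} (p : Fin κ → ℝ) {f : α → Fin κ → SL2}
    {A : Fin κ → SL2} (hf : Tendsto f l (𝓝 A)) (h : ∀ i, (A i : Mat2) 1 1 ≠ 0) :
    Tendsto (fun x => ∑ i, p i * Real.log |(f x i : Mat2) 1 1|) l
      (𝓝 (∑ i, p i * Real.log |(A i : Mat2) 1 1|)) := by
  refine tendsto_finsetSum _ fun i _ => Tendsto.const_mul (p i) ?_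
  exact ((tendsto_entry hf i 1 1).abs).log (abs_ne_zero.2 (h i))

lemma core1 {p : Fin κ → ℝ} (hp : ∀ i, 0 < p i) (hp1 : ∑ i, p i = 1) (A : Fin κ → SL2)
    (hA : ∀ i, (A i : Mat2) 1 0 = 0) (i0 : Fin κ)
    (hne : (A i0 : Mat2) 0 0 ≠ (A i0 : Mat2) 1 1)
    (hχ : 0 < ∑ i, p i * Real.log |(A i : Mat2) 1 1|)
    {ε : ℝ} (hε : 0 < ε) {α : Type*} (u : Ultrafilter α) (f : α → Fin κ → SL2)
    (hf : Tendsto f u (𝓝 A)) (hf0 : ∀ᶠ x in (u : Filter α), (f x i0 : Mat2) 1 0 = 0) :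
    ∀ᶠ x in (u : Filter α), ∑ i, p i * Real.log |(A i : Mat2) 1 1| - ε ≤ lyapLC p (f x) := by
  have hdet := fun i => entry_ne (Or.inl (hA i))
  set M : α → ℝ := fun x => ∑ i, |(f x i : Mat2) 1 0| with hM
  have hM0 : ∀ x, 0 ≤ M x := fun x => Finset.sum_nonneg fun i _ => abs_nonneg _
  have hMlim : Tendsto M u (𝓝 0) := by
    have : Tendsto M u (𝓝 (∑ i, |(A i : Mat2) 1 0|)) :=
      tendsto_finsetSum _ fun i _ => (tendsto_entry hf i 1 0).abs
    simpa [hA] using this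
  rcases Ultrafilter.eventually_or.1 (Eventually.of_forall (f := (u : Filter α))
    fun x => em (M x = 0)) with hz | hz
  · have h1 := (tendsto_chi p hf (fun i => right_ne_zero_of_mul_eq_one (hdet i))).eventually_const_lt
      (show ∑ i, p i * Real.log |(A i : Mat2) 1 1| - ε < ∑ i, p i * Real.log |(A i : Mat2) 1 1| by
        linarith)
    filter_upwards [h1, hz] with x hx hzx
    refine hx.le.trans (lyap_ge_upper hp hp1 (f x) fun i => ?_)
    have := (Finset.sum_eq_zero_iff_of_nonneg fun i _ => abs_nonneg _).1 hzx i (Finset.mem_univ i)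
    exact abs_eq_zero.1 this
  have hpos : ∀ᶠ x in (u : Filter α), 0 < M x :=
    hz.mono fun x hx => lt_of_le_of_ne (hM0 x) (Ne.symm hx)
  have hbound : ∀ i x, |(f x i : Mat2) 1 0| ≤ M x := fun i x =>
    Finset.single_le_sum (f := fun i => |(f x i : Mat2) 1 0|) (fun i _ => abs_nonneg _)
      (Finset.mem_univ i)
  have hlim : ∀ i, ∃ c : ℝ, Tendsto (fun x => (f x i : Mat2) 1 0 / M x) u (𝓝 c) := by
    intro i
    obtain ⟨c, -, hc⟩ := (isCompact_Icc (a := (-1 : ℝ)) (b := 1)).ultrafilter_le_nhds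
      (u.map fun x => (f x i : Mat2) 1 0 / M x)
      (le_principal_iff.2 (Filter.mem_map.2 (Filter.univ_mem' fun x => by
        have : |(f x i : Mat2) 1 0 / M x| ≤ 1 := by
          rw [abs_div, abs_of_nonneg (hM0 x)]
          exact div_le_one_of_le₀ (hbound i x) (hM0 x)
        exact abs_le.1 this)))
    exact ⟨c, hc⟩
  choose c hc using hlim
  have hcsum : ∑ i, |c i| = 1 := by
    have h1 : Tendsto (fun x => ∑ i, |(f x i : Mat2) 1 0 / M x|) u (𝓝 (∑ i, |c i|)) :=
      tendsto_finsetSum _ fun i _ => (hc i).abs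
    refine tendsto_nhds_unique h1 (tendsto_const_nhds.congr' ?_)
    filter_upwards [hpos] with x hx
    simp only [abs_div, ← Finset.sum_div, abs_of_pos hx]
    exact (div_self hx.ne').symm
  have hc0 : c i0 = 0 := by
    refine tendsto_nhds_unique (hc i0) (tendsto_const_nhds.congr' ?_)
    filter_upwards [hf0] with x hx
    rw [hx, zero_div]
  have hcne : ∃ i, c i ≠ 0 := by
    by_contra hcon
    push Not at hcon
    simp [hcon] at hcsum
  -- the limit cocycle
  set A' : Fin κ → SL2 := fun i =>
    mk2 ((A i : Mat2) 0 0) 0 (c i) ((A i : Mat2) 1 1) (by rw [hdet i]; ring) with hA'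
  set R : α → ℝ := fun x => if 0 < M x then Real.sqrt (M x) else 1 with hR
  have hRpos : ∀ x, 0 < R x := by
    intro x
    simp only [hR]
    split_ifs with h
    · exact Real.sqrt_pos.2 h
    · exact one_pos
  set D : α → SL2 := fun x =>
    mk2 (R x) 0 0 (R x)⁻¹ (by rw [mul_inv_cancel₀ (hRpos x).ne']; ring) with hD
  set g : α → Fin κ → SL2 := fun x i => D x * f x i * (D x)⁻¹ with hg
  have hgL : ∀ x, lyapLC p (g x) = lyapLC p (f x) := fun x => lyap_conj hp hp1 (f x) (D x)
  have hent : ∀ᶠ x in (u : Filter α), ∀ i,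
      (g x i : Mat2) 0 0 = (f x i : Mat2) 0 0 ∧ (g x i : Mat2) 0 1 = M x * (f x i : Mat2) 0 1 ∧
      (g x i : Mat2) 1 0 = (f x i : Mat2) 1 0 / M x ∧ (g x i : Mat2) 1 1 = (f x i : Mat2) 1 1 := by
    filter_upwards [hpos] with x hx i
    have hRM : R x ^ 2 = M x := by
      simp only [hR, if_pos hx]; exact Real.sq_sqrt hx.le
    have hR0 := (hRpos x).ne'
    simp only [hg, mul_entry, inv_00, inv_01, inv_10, inv_11, hD, mk2_00, mk2_01, mk2_10, mk2_11,
      ← hRM]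
    refine ⟨?_, ?_, ?_, ?_⟩ <;> field_simp <;> ring
  have hgA : Tendsto g u (𝓝 A') := by
    refine tendsto_SL fun i j k => ?_
    fin_cases j <;> fin_cases k
    · refine (tendsto_entry hf i 0 0).congr' ?_
      filter_upwards [hent] with x hx
      exact (hx i).1.symm
    · have h1 := hMlim.mul (tendsto_entry hf i 0 1)
      rw [zero_mul] at h1
      refine h1.congr' ?_
      filter_upwards [hent] with x hx
      exact (hx i).2.1.symm
    · refine (hc i).congr' ?_
      filter_upwards [hent] with x hx
      exact (hx i).2.2.1.symm
    · refine (tendsto_entry hf i 1 1).congr' ?_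
      filter_upwards [hent] with x hx
      exact (hx i).2.2.2.symm
  have hfin := hgA.eventually (lower_uniform hp hp1 A' (fun i => mk2_01 _) i0 hc0 hne hχ hcne hε)
  filter_upwards [hfin] with x hx
  rw [hgL] at hx
  exact hx

lemma core2 {p : Fin κ → ℝ} (hp : ∀ i, 0 < p i) (hp1 : ∑ i, p i = 1) (A : Fin κ → SL2)
    (hA : ∀ i, (A i : Mat2) 1 0 = 0)
    (hχ : 0 < ∑ i, p i * Real.log |(A i : Mat2) 1 1|)
    {ε : ℝ} (hε : 0 < ε) :
    ∀ᶠ B in 𝓝 A, ∑ i, p i * Real.log |(A i : Mat2) 1 1| - ε ≤ lyapLC p B := by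
  obtain ⟨i0, -, hi0⟩ := Finset.exists_lt_of_sum_lt (s := Finset.univ) (f := fun _ => (0 : ℝ))
    (g := fun i => p i * Real.log |(A i : Mat2) 1 1|) (by simpa using hχ)
  have hlog : 0 < Real.log |(A i0 : Mat2) 1 1| := pos_of_mul_pos_right hi0 (hp i0).le
  have hd : 1 < |(A i0 : Mat2) 1 1| := (Real.log_pos_iff (abs_nonneg _)).1 hlog
  have hne : (A i0 : Mat2) 0 0 ≠ (A i0 : Mat2) 1 1 := by
    intro h
    have h1 := entry_ne (Or.inl (hA i0))
    rw [h, ← abs_mul_abs_self] at h1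
    nlinarith
  set s : (Fin κ → SL2) → ℝ := fun B => (B i0 : Mat2) 0 0 - (B i0 : Mat2) 1 1 with hs
  set w : (Fin κ → SL2) → ℝ := fun B =>
    1 + Real.sqrt (1 + 4 * ((B i0 : Mat2) 0 1 * (B i0 : Mat2) 1 0) / s B ^ 2) with hw
  set t : (Fin κ → SL2) → ℝ := fun B => 2 * (B i0 : Mat2) 1 0 / (s B * w B) with ht
  have ent := fun i j k => tendsto_entry (tendsto_id (α := Fin κ → SL2) (x := 𝓝 A)) i j k
  simp only [id] at ent
  have hsA : s A ≠ 0 := sub_ne_zero.2 hne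
  have hslim : Tendsto s (𝓝 A) (𝓝 (s A)) := (ent i0 0 0).sub (ent i0 1 1)
  have hrlim : Tendsto (fun B : Fin κ → SL2 =>
      1 + 4 * ((B i0 : Mat2) 0 1 * (B i0 : Mat2) 1 0) / s B ^ 2) (𝓝 A) (𝓝 1) := by
    have := (((((ent i0 0 1).mul (ent i0 1 0)).const_mul 4).div (hslim.pow 2)
      (pow_ne_zero 2 hsA))).const_add 1
    simpa [hA] using this
  have hwlim : Tendsto w (𝓝 A) (𝓝 2) := by
    have := (hrlim.sqrt).const_add 1
    rw [Real.sqrt_one, one_add_one_eq_two] at this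
    exact this
  have htlim : Tendsto t (𝓝 A) (𝓝 0) := by
    have := ((ent i0 1 0).const_mul 2).div (hslim.mul hwlim) (mul_ne_zero hsA two_ne_zero)
    rw [hA, mul_zero, zero_div] at this
    exact this
  set P : (Fin κ → SL2) → SL2 := fun B => mk2 1 0 (-t B) 1 (by ring) with hP
  set g : (Fin κ → SL2) → Fin κ → SL2 := fun B i => P B * B i * (P B)⁻¹ with hg
  have hgL : ∀ B, lyapLC p (g B) = lyapLC p B := fun B => lyap_conj hp hp1 B (P B)
  have hent : ∀ B i,
      (g B i : Mat2) 0 0 = (B i : Mat2) 0 0 + (B i : Mat2) 0 1 * t B ∧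
      (g B i : Mat2) 0 1 = (B i : Mat2) 0 1 ∧
      (g B i : Mat2) 1 0 = (B i : Mat2) 1 0 - ((B i : Mat2) 0 0 - (B i : Mat2) 1 1) * t B
        - (B i : Mat2) 0 1 * t B ^ 2 ∧
      (g B i : Mat2) 1 1 = (B i : Mat2) 1 1 - t B * (B i : Mat2) 0 1 := by
    intro B i
    simp only [hg, mul_entry, inv_00, inv_01, inv_10, inv_11, hP, mk2_00, mk2_01, mk2_10, mk2_11]
    refine ⟨?_, ?_, ?_, ?_⟩ <;> ring
  have hgA : Tendsto g (𝓝 A) (𝓝 A) := by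
    refine tendsto_SL fun i j k => ?_
    fin_cases j <;> fin_cases k
    · have := (ent i 0 0).add ((ent i 0 1).mul htlim)
      rw [mul_zero, add_zero] at this
      exact this.congr fun B => (hent B i).1.symm
    · exact (ent i 0 1).congr fun B => (hent B i).2.1.symm
    · have := ((ent i 1 0).sub (((ent i 0 0).sub (ent i 1 1)).mul htlim)).sub
        ((ent i 0 1).mul (htlim.pow 2))
      rw [mul_zero, sub_zero, zero_pow two_ne_zero, mul_zero, sub_zero] at this
      exact this.congr fun B => (hent B i).2.2.1.symm
    · have := (ent i 1 1).sub (htlim.mul (ent i 0 1))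
      rw [zero_mul, sub_zero] at this
      exact this.congr fun B => (hent B i).2.2.2.symm
  have hg0 : ∀ᶠ B in 𝓝 A, (g B i0 : Mat2) 1 0 = 0 := by
    filter_upwards [hslim.eventually_ne hsA, hrlim.eventually_const_lt one_half_lt_one]
      with B hsB hrB
    rw [(hent B i0).2.2.1]
    have hr0 : 0 ≤ 1 + 4 * ((B i0 : Mat2) 0 1 * (B i0 : Mat2) 1 0) / s B ^ 2 := by linarith
    have hw0 : w B ≠ 0 := by
      have : 0 < w B := by simp only [hw]; positivity
      exact this.ne'
    have hww : (w B - 1) ^ 2 = 1 + 4 * ((B i0 : Mat2) 0 1 * (B i0 : Mat2) 1 0) / s B ^ 2 := by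
      simp only [hw, add_sub_cancel_left]; exact Real.sq_sqrt hr0
    have hww' : s B ^ 2 * (w B ^ 2 - 2 * w B) = 4 * ((B i0 : Mat2) 0 1 * (B i0 : Mat2) 1 0) := by
      have : 4 * ((B i0 : Mat2) 0 1 * (B i0 : Mat2) 1 0) / s B ^ 2 = w B ^ 2 - 2 * w B := by
        linear_combination -hww
      rw [← this]; field_simp
    have e1 : (B i0 : Mat2) 0 0 - (B i0 : Mat2) 1 1 = s B := rfl
    have e2 : t B = 2 * (B i0 : Mat2) 1 0 / (s B * w B) := rfl
    rw [e1, e2]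
    generalize s B = S at *
    generalize w B = W at *
    generalize (B i0 : Mat2) 1 0 = γ at *
    generalize (B i0 : Mat2) 0 1 = β at *
    field_simp
    linear_combination γ * hww'
  refine mem_iff_ultrafilter.2 fun u hu => ?_
  have := core1 hp hp1 A hA i0 hne hχ hε u g (hgA.mono_left hu) (hg0.filter_mono hu)
  filter_upwards [this] with B hB
  rw [hgL] at hB
  exact hB

lemma lsc {p : Fin κ → ℝ} (hp : ∀ i, 0 < p i) (hp1 : ∑ i, p i = 1) (A : Fin κ → SL2)
    {ε : ℝ} (hε : 0 < ε) : ∀ᶠ B in 𝓝 A, lyapLC p A - ε ≤ lyapLC p B := by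
  rcases dichotomy hp hp1 A with h | ⟨c, hc0, hcL, h⟩
  · exact lsc_of_uniform hp hp1 A h hε
  obtain ⟨v, hv, hinv, hH⟩ := h (min (ε / 2) (-c / 2)) (lt_min (by linarith) (by linarith))
  have hn : v 0 ^ 2 + v 1 ^ 2 = 1 := by rw [← normsq v, hv]; norm_num
  set Q : SL2 := mk2 (v 0) (v 1) (-v 1) (v 0) (by linarith) with hQ
  set T : (Fin κ → SL2) → Fin κ → SL2 := fun B i => Q * B i * Q⁻¹ with hT
  have hTL : ∀ B, lyapLC p (T B) = lyapLC p B := fun B => lyap_conj hp hp1 B Q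
  have hTc : Tendsto T (𝓝 A) (𝓝 (T A)) := by
    have ent := fun i j k => tendsto_entry (tendsto_id (α := Fin κ → SL2) (x := 𝓝 A)) i j k
    simp only [id] at ent
    refine tendsto_SL fun i j k => ?_
    simp only [hT, mul_entry]
    exact ((((ent i 0 0).const_mul _).add ((ent i 1 0).const_mul _)).mul_const _).add
      ((((ent i 0 1).const_mul _).add ((ent i 1 1).const_mul _)).mul_const _)
  have h10 : ∀ i, (T A i : Mat2) 1 0 = 0 := by
    intro i
    have := hinv i
    simp only [om, toEuc_apply0, toEuc_apply1] at this
    simp only [hT, mul_entry, inv_00, inv_01, inv_10, inv_11, hQ, mk2_00, mk2_01, mk2_10, mk2_11]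
    linear_combination -this
  have h00 : ∀ i, |(T A i : Mat2) 0 0| = ‖toEuc (A i) v‖ := by
    intro i
    rw [← abs_of_nonneg (norm_nonneg (toEuc (A i) v)), ← sq_eq_sq_iff_abs_eq_abs, normsq]
    have h1 := hinv i
    have h2 : (T A i : Mat2) 0 0 = v 0 * toEuc (A i) v 0 + v 1 * toEuc (A i) v 1 := by
      rw [toEuc_apply0, toEuc_apply1]
      simp only [hT, mul_entry, inv_00, inv_01, inv_10, inv_11, hQ, mk2_00, mk2_01, mk2_10, mk2_11]
      ring
    rw [h2]
    simp only [om] at h1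
    generalize toEuc (A i) v 0 = x at *
    generalize toEuc (A i) v 1 = y at *
    linear_combination (x ^ 2 + y ^ 2) * hn - (x * v 1 - y * v 0) * h1
  have hsum : ∑ i, p i * Real.log |(T A i : Mat2) 1 1| = -H p A 1 v := by
    rw [H_one, ← Finset.sum_neg_distrib]
    refine Finset.sum_congr rfl fun i _ => ?_
    have h1 := entry_ne (Or.inl (h10 i))
    have h2 : (T A i : Mat2) 1 1 = ((T A i : Mat2) 0 0)⁻¹ := eq_inv_of_mul_eq_one_right h1
    rw [h2, abs_inv, h00, Real.log_inv]; ring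
  have m1 := min_le_left (ε / 2) (-c / 2)
  have m2 := min_le_right (ε / 2) (-c / 2)
  have key := hTc.eventually (core2 hp hp1 (T A) h10 (by rw [hsum]; linarith) (half_pos hε))
  filter_upwards [key] with B hB
  rw [hTL, hsum] at hB
  linarith

lemma continuous_lyap {p : Fin κ → ℝ} (hp : ∀ i, 0 < p i) (hp1 : ∑ i, p i = 1) :
    Continuous (fun A : Fin κ → SL2 => lyapLC p A) := by
  refine continuous_iff_continuousAt.2 fun A => Metric.tendsto_nhds.2 fun ε hε => ?_
  filter_upwards [usc hp hp1 A hε, lsc hp hp1 A (half_pos hε)] with B h1 h2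
  rw [Real.dist_eq, abs_lt]
  constructor <;> linarith

end BV

/-- **Bocker–Viana continuity theorem.** For any fixed probability vector with positive
entries, the Lyapunov exponent `L : SL₂(ℝ)^κ → ℝ` is continuous. -/
theorem bocker_viana_continuity {κ : ℕ} (hκ : 2 ≤ κ) (p : Fin κ → ℝ)
    (hp : ∀ i, 0 < p i) (hp1 : ∑ i, p i = 1) :
    Continuous (fun A : Fin κ → SL2 => lyapLC p A) := by
  exact BV.continuous_lyap hp hp1
end
end
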